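/- arXiv:2011.14692 — 4 statements merged into one kernel-verified Lean document; each statement's English description precedes it below -/
import Mathlib

section
/- Let I ⊆ S = k[α_0,…,α_n] be a homogeneous radical ideal such that for some positive integer r one has dim_k (S/I)_d = r for all sufficiently large d (i.e. the Hilbert polynomial of S/I is the constant r). Then for every positive integer k, dim_k (S/I^k)_d = r · C(n+k−1, n) for all sufficiently large d, where C(n+k−1, n) = dim_k S_{k−1} is a binomial coefficient. -/
open MvPolynomial

/-- The Hilbert function of `S/I`: the `k`-dimension of the degree-`d` graded piece of `S/I`,
realized as the image of the space of homogeneous degree-`d` polynomials in the quotient. -/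
noncomputable def hilb (k : Type*) [Field k] (n : ℕ)
    (I : Ideal (MvPolynomial (Fin (n+1)) k)) (d : ℕ) : ℕ :=
  Module.finrank k
    ((homogeneousSubmodule (Fin (n+1)) k d).map (Ideal.Quotient.mkₐ k I).toLinearMap)

attribute [local instance] MvPolynomial.gradedAlgebra


namespace HilbPow

variable {k : Type*} [Field k] {n : ℕ}

lemma eval_smul_hom {f : MvPolynomial (Fin (n+1)) k} {d : ℕ} (hf : f.IsHomogeneous d)
    (t : k) (p : Fin (n+1) → k) : eval (t • p) f = t ^ d * eval p f := by
  rw [eval_eq, eval_eq, Finset.mul_sum]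
  refine Finset.sum_congr rfl fun m hm => ?_
  have h := hf.degree_eq_sum_deg_support hm
  simp only [Pi.smul_apply, smul_eq_mul, mul_pow, Finset.prod_mul_distrib]
  rw [Finset.prod_pow_eq_pow_sum, ← h]
  ring

/-- The ideal of the line through `p`. -/
def lineIdeal (p : Fin (n+1) → k) : Ideal (MvPolynomial (Fin (n+1)) k) where
  carrier := {f | ∀ t : k, eval (t • p) f = 0}
  add_mem' := by
    intro a b ha hb t
    simp [ha t, hb t]
  zero_mem' := by intro t; simp
  smul_mem' := by
    intro c x hx t
    simp [hx t]

lemma mem_lineIdeal {p : Fin (n+1) → k} {f : MvPolynomial (Fin (n+1)) k} :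
    f ∈ lineIdeal p ↔ ∀ t : k, eval (t • p) f = 0 := Iff.rfl

lemma mem_lineIdeal_of_hom {p : Fin (n+1) → k} {f : MvPolynomial (Fin (n+1)) k} {d : ℕ}
    (hf : f.IsHomogeneous d) (h : eval p f = 0) : f ∈ lineIdeal p := by
  intro t
  rw [eval_smul_hom hf, h, mul_zero]

lemma eval_of_mem_lineIdeal {p : Fin (n+1) → k} {f : MvPolynomial (Fin (n+1)) k}
    (h : f ∈ lineIdeal p) : eval p f = 0 := by
  simpa using h 1

/-- restriction to the line `p + t v` -/
noncomputable def taylor (p v : Fin (n+1) → k) :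
    MvPolynomial (Fin (n+1)) k →ₐ[k] Polynomial k :=
  aeval (fun i => Polynomial.C (p i) + Polynomial.X * Polynomial.C (v i))

lemma eval_taylor (p v : Fin (n+1) → k) (f : MvPolynomial (Fin (n+1)) k) (t : k) :
    (taylor p v f).eval t = eval (p + t • v) f := by
  have : ((Polynomial.aeval t).comp (taylor p v)) = aeval (p + t • v) := by
    ext i
    simp [taylor]
    ring
  have h := congrArg (fun g => g f) this
  simpa [aeval_eq_eval] using h

lemma X_pow_dvd_taylor {p : Fin (n+1) → k} {f : MvPolynomial (Fin (n+1)) k} {K : ℕ}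
    (hf : f ∈ lineIdeal p ^ K) (v : Fin (n+1) → k) :
    Polynomial.X ^ K ∣ taylor p v f := by
  have h1 : lineIdeal p ≤ Ideal.comap (taylor p v) (Ideal.span {Polynomial.X}) := by
    intro g hg
    rw [Ideal.mem_comap, Ideal.mem_span_singleton, Polynomial.X_dvd_iff,
      Polynomial.coeff_zero_eq_eval_zero, eval_taylor]
    simpa using eval_of_mem_lineIdeal hg
  have h2 := (Ideal.pow_right_mono h1 K).trans (Ideal.le_comap_pow _ K) hf
  rwa [Ideal.mem_comap, Ideal.span_singleton_pow, Ideal.mem_span_singleton] at h2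

lemma eq_zero_of_mul_mem [Infinite k] {p : Fin (n+1) → k} {u g : MvPolynomial (Fin (n+1)) k}
    {K : ℕ} (hu : eval p u ≠ 0) (hg : g.IsHomogeneous K)
    (h : u * g ∈ lineIdeal p ^ (K+1)) : g = 0 := by
  have key : ∀ v, taylor p v g = 0 := by
    intro v
    have h1 := X_pow_dvd_taylor h v
    rw [map_mul] at h1
    have h2 : IsCoprime (Polynomial.X ^ (K+1)) (taylor p v u) := by
      apply IsCoprime.pow_left
      rw [Polynomial.irreducible_X.coprime_iff_not_dvd, Polynomial.X_dvd_iff,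
        Polynomial.coeff_zero_eq_eval_zero, eval_taylor]
      simpa using hu
    have h3 := h2.dvd_of_dvd_mul_left h1
    refine Polynomial.eq_zero_of_dvd_of_natDegree_lt h3 ?_
    rw [Polynomial.natDegree_X_pow]
    have : (taylor p v g).natDegree ≤ K * 1 := by
      refine (MvPolynomial.aeval_natDegree_le g hg.totalDegree_le
        (fun i => Polynomial.C (p i) + Polynomial.X * Polynomial.C (v i)) ?_)
      intro i
      compute_degree
    omega
  refine MvPolynomial.funext fun x => ?_
  have := eval_taylor p (x - p) g 1
  rw [key] at this
  simpa using this.symm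

lemma exists_sub_mem {p : Fin (n+1) → k} {l : MvPolynomial (Fin (n+1)) k}
    (hl : l.IsHomogeneous 1) (hlp : eval p l = 1) (m : ℕ) :
    ∀ s K : ℕ, s + K = m → ∀ f : MvPolynomial (Fin (n+1)) k, f.IsHomogeneous (s + K) →
      ∃ g : MvPolynomial (Fin (n+1)) k, g.IsHomogeneous K ∧ f - l ^ s * g ∈ lineIdeal p ^ (K+1) := by
  induction m with
  | zero =>
    intro s K h f hf
    obtain ⟨rfl, rfl⟩ : s = 0 ∧ K = 0 := by omega
    exact ⟨f, by simpa using hf, by simp⟩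
  | succ m ih =>
    intro s K h f hf
    rcases s with _ | s
    · exact ⟨f, by simpa using hf, by simp⟩
    rcases K with _ | K
    · refine ⟨C (eval p f), isHomogeneous_C _ _, ?_⟩
      rw [zero_add, pow_one]
      refine mem_lineIdeal_of_hom (d := s + 1) (hf.sub ?_) ?_
      · simpa using (hl.pow (s+1)).mul (isHomogeneous_C (Fin (n+1)) (eval p f))
      · simp [hlp]
    have hfmul : f ∈ homogeneousSubmodule (Fin (n+1)) k m * homogeneousSubmodule (Fin (n+1)) k 1 := by
      rw [← homogeneousSubmodule_one_pow (σ := Fin (n+1)) (R := k) m, ← pow_succ, homogeneousSubmodule_one_pow, ← h]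
      exact hf
    clear hf
    induction hfmul using Submodule.mul_induction_on' with
    | mem_mul_mem a ha b hb =>
      rw [mem_homogeneousSubmodule] at ha hb
      obtain ⟨g, hg, hag⟩ := ih s (K+1) (by omega) a (by convert ha using 1; omega)
      obtain ⟨w, hw, haw⟩ := ih (s+1) K (by omega) a (by convert ha using 1; omega)
      have hy : (b - C (eval p b) * l).IsHomogeneous 1 :=
        hb.sub (hl.C_mul _)
      have hyp : b - C (eval p b) * l ∈ lineIdeal p := mem_lineIdeal_of_hom hy (by simp [hlp])
      refine ⟨C (eval p b) * g + (b - C (eval p b) * l) * w, ?_, ?_⟩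
      · refine (hg.C_mul _).add ?_
        rw [add_comm K 1]
        exact hy.mul hw
      · have e : a * b - l ^ (s+1) * (C (eval p b) * g + (b - C (eval p b) * l) * w) =
          (C (eval p b) * l) * (a - l ^ s * g) +
            (a - l ^ (s+1) * w) * (b - C (eval p b) * l) := by ring
        rw [e]
        refine add_mem (Ideal.mul_mem_left _ _ hag) ?_
        rw [pow_succ]
        exact Ideal.mul_mem_mul haw hyp
    | add x hx y hy ihx ihy =>
      obtain ⟨g, hg, h1⟩ := ihx
      obtain ⟨w, hw, h2⟩ := ihy
      refine ⟨g + w, hg.add hw, ?_⟩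
      convert add_mem h1 h2 using 1
      ring

lemma exists_linear_one {p : Fin (n+1) → k} (hp : p ≠ 0) :
    ∃ l : MvPolynomial (Fin (n+1)) k, l.IsHomogeneous 1 ∧ eval p l = 1 := by
  obtain ⟨c, hc⟩ := Function.ne_iff.mp hp
  exact ⟨C (p c)⁻¹ * X c, isHomogeneous_C_mul_X _ _, by simpa using inv_mul_cancel₀ hc⟩

lemma exists_linear_sep {p q : Fin (n+1) → k} (hq : q ≠ 0) (hpq : ∀ a : k, p ≠ a • q) :
    ∃ l : MvPolynomial (Fin (n+1)) k, l.IsHomogeneous 1 ∧ eval p l = 1 ∧ eval q l = 0 := by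
  obtain ⟨c, hc⟩ := Function.ne_iff.mp hq
  obtain ⟨j, hj⟩ := Function.ne_iff.mp (hpq (p c / q c))
  simp only [Pi.zero_apply, Pi.smul_apply, smul_eq_mul, ne_eq] at hc hj
  have hu : p j - p c / q c * q j ≠ 0 := sub_ne_zero.mpr hj
  refine ⟨C (p j - p c / q c * q j)⁻¹ * (X j - C (q j / q c) * X c), ?_, ?_, ?_⟩
  · exact ((isHomogeneous_X _ _).sub (isHomogeneous_C_mul_X _ _)).C_mul _
  · simp only [map_mul, eval_C, map_sub, eval_X]
    rw [inv_mul_eq_one₀ hu]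
    ring
  · simp only [map_mul, eval_C, map_sub, eval_X]
    rw [div_mul_cancel₀ _ hc]; simp

lemma exists_sep {ι : Type*} [Fintype ι] (p : ι → Fin (n+1) → k) (hp : ∀ i, p i ≠ 0)
    (hpp : ∀ i j, i ≠ j → ∀ a : k, p i ≠ a • p j) :
    ∃ (D : ℕ) (e : ι → MvPolynomial (Fin (n+1)) k), ∀ i, (e i).IsHomogeneous D ∧
      eval (p i) (e i) = 1 ∧ ∀ j, j ≠ i → eval (p j) (e i) = 0 := by
  classical
  have : ∀ i j, ∃ l : MvPolynomial (Fin (n+1)) k, l.IsHomogeneous 1 ∧ eval (p i) l = 1 ∧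
      (j ≠ i → eval (p j) l = 0) := by
    intro i j
    by_cases h : j = i
    · obtain ⟨l, h1, h2⟩ := exists_linear_one (hp i)
      exact ⟨l, h1, h2, fun hne => absurd h hne⟩
    · obtain ⟨l, h1, h2, h3⟩ := exists_linear_sep (hp j) (hpp i j (Ne.symm h))
      exact ⟨l, h1, h2, fun _ => h3⟩
  choose l h1 h2 h3 using this
  refine ⟨∑ _i : ι, 1, fun i => ∏ j, l i j, fun i => ⟨?_, ?_, ?_⟩⟩
  · exact IsHomogeneous.prod _ _ _ fun j _ => h1 i j
  · simp [map_prod, h2]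
  · intro j hj
    rw [map_prod]
    exact Finset.prod_eq_zero (Finset.mem_univ j) (h3 i j hj)

lemma hcomp_mul {a E : MvPolynomial (Fin (n+1)) k} {D : ℕ} (hE : E.IsHomogeneous D) (m : ℕ) :
    homogeneousComponent (m + D) (a * E) = homogeneousComponent m a * E := by
  conv_lhs => rw [← sum_homogeneousComponent a, Finset.sum_mul, map_sum]
  have : ∀ i, homogeneousComponent (m + D) (homogeneousComponent i a * E) =
      if m = i then homogeneousComponent i a * E else 0 := by
    intro i
    rw [homogeneousComponent_of_mem (n := i + D)
      ((homogeneousComponent_isHomogeneous i a).mul hE)]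
    simp
  simp only [this, Finset.sum_ite_eq, Finset.mem_range]
  split_ifs with h
  · rfl
  · rw [homogeneousComponent_eq_zero _ _ (by omega), zero_mul]

lemma finrank_hom (K : ℕ) :
    Module.finrank k (homogeneousSubmodule (Fin (n+1)) k K) = (n + K).choose n := by
  classical
  have hs : ({d | d.degree = K} : Set (Fin (n+1) →₀ ℕ)) =
      (Finset.univ.finsuppAntidiag K : Finset (Fin (n+1) →₀ ℕ)) := by
    ext d
    simp [Finset.mem_finsuppAntidiag, Finsupp.degree_eq_sum]
  rw [homogeneousSubmodule_eq_finsupp_supported, hs,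
    (AddMonoidAlgebra.supportedEquivFinsupp _).finrank_eq, Module.finrank_finsupp_self]
  simp [Finset.card_finsuppAntidiag_nat_eq_choose]
  exact Nat.choose_symm_add.symm


lemma sup_pow_le {R : Type*} [CommRing R] (A J : Ideal R) (K : ℕ) :
    (A ⊔ J) ^ K ≤ A ⊔ J ^ K := by
  induction K with
  | zero => simp
  | succ K ih =>
    rw [pow_succ, pow_succ]
    refine Ideal.mul_le.mpr fun x hx y hy => ?_
    obtain ⟨a, ha, b, hb, rfl⟩ := Submodule.mem_sup.mp (ih hx)
    obtain ⟨c, hc, d, hd, rfl⟩ := Submodule.mem_sup.mp hy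
    have e : (a + b) * (c + d) = (a * (c + d) + b * c) + b * d := by ring
    rw [e]
    exact Submodule.add_mem_sup
      (add_mem (Ideal.mul_mem_right _ _ ha) (Ideal.mul_mem_left _ _ hc))
      (Ideal.mul_mem_mul hb hd)

/-- The parametrizing map `(g_i) ↦ ∑ u_i g_i mod J`. -/
noncomputable def param {ι : Type*} [Fintype ι] (J : Ideal (MvPolynomial (Fin (n+1)) k))
    (u : ι → MvPolynomial (Fin (n+1)) k) (K : ℕ) :
    (ι → homogeneousSubmodule (Fin (n+1)) k K) →ₗ[k] (MvPolynomial (Fin (n+1)) k ⧸ J) :=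
  (Ideal.Quotient.mkₐ k J).toLinearMap ∘ₗ
    ∑ i, LinearMap.mulLeft k (u i) ∘ₗ (homogeneousSubmodule (Fin (n+1)) k K).subtype ∘ₗ
      LinearMap.proj i

lemma param_apply {ι : Type*} [Fintype ι] (J : Ideal (MvPolynomial (Fin (n+1)) k))
    (u : ι → MvPolynomial (Fin (n+1)) k) (K : ℕ)
    (g : ι → homogeneousSubmodule (Fin (n+1)) k K) :
    param J u K g = Ideal.Quotient.mk J (∑ i, u i * (g i : MvPolynomial (Fin (n+1)) k)) := by
  simp [param]

instance finite_hom (K : ℕ) : Module.Finite k (homogeneousSubmodule (Fin (n+1)) k K) :=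
  Module.Finite.iff_fg.mpr (homogeneousSubmodule_fg _ _ K)

lemma finrank_dom {ι : Type*} [Fintype ι] (K : ℕ) :
    Module.finrank k (ι → homogeneousSubmodule (Fin (n+1)) k K) =
      Fintype.card ι * (n + K).choose n := by
  rw [Module.finrank_pi_fintype]
  simp [finrank_hom]

lemma lower {ι : Type*} [Fintype ι] [Infinite k] (p : ι → Fin (n+1) → k) (hp : ∀ i, p i ≠ 0)
    (hpp : ∀ i j, i ≠ j → ∀ a : k, p i ≠ a • p j) (K : ℕ)
    (J : Ideal (MvPolynomial (Fin (n+1)) k)) (hJ : ∀ i, J ≤ lineIdeal (p i) ^ (K+1)) :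
    ∃ D : ℕ, ∀ d ≥ D, Fintype.card ι * (n + K).choose n ≤ hilb k n J d := by
  classical
  obtain ⟨D, e, he⟩ := exists_sep p hp hpp
  choose l hl hlp using fun i => exists_linear_one (hp i)
  refine ⟨D * (K+1) + K, fun d hd => ?_⟩
  obtain ⟨s, rfl⟩ := Nat.exists_eq_add_of_le hd
  set u : ι → MvPolynomial (Fin (n+1)) k := fun i => e i ^ (K+1) * l i ^ s with hu
  have hinj : Function.Injective (param J u K) := by
    rw [← LinearMap.ker_eq_bot, LinearMap.ker_eq_bot']
    intro g hg
    rw [param_apply, Ideal.Quotient.eq_zero_iff_mem] at hg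
    funext i
    have h1 := hJ i hg
    rw [← Finset.add_sum_erase _ _ (Finset.mem_univ i)] at h1
    have h2 : ∑ j ∈ Finset.univ.erase i, u j * (g j : MvPolynomial (Fin (n+1)) k) ∈
        lineIdeal (p i) ^ (K+1) := by
      refine sum_mem fun j hj => ?_
      refine Ideal.mul_mem_right _ _ (Ideal.mul_mem_right _ _ (Ideal.pow_mem_pow ?_ _))
      exact mem_lineIdeal_of_hom (he j).1 ((he j).2.2 i (Finset.ne_of_mem_erase hj).symm)
    have h3 := (Ideal.add_mem_iff_left _ h2).mp h1
    apply Subtype.ext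
    refine eq_zero_of_mul_mem (p := p i) ?_ (g i).2 h3
    simp [hu, (he i).2.1, hlp i]
  rw [← finrank_dom (k := k) K, ← LinearMap.finrank_range_of_inj hinj]
  unfold hilb
  have : Module.Finite k ((homogeneousSubmodule (Fin (n+1)) k (D * (K+1) + K + s)).map
    (Ideal.Quotient.mkₐ k J).toLinearMap) := inferInstance
  refine Submodule.finrank_mono ?_
  rintro _ ⟨g, rfl⟩
  rw [param_apply]
  refine ⟨_, ?_, rfl⟩
  refine sum_mem fun i _ => ?_
  have := ((((he i).1.pow (K+1)).mul ((hl i).pow s)).mul (g i).2)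
  rw [mem_homogeneousSubmodule]
  convert this using 1
  ring

lemma upper {ι : Type*} [Fintype ι] (p : ι → Fin (n+1) → k) (hp : ∀ i, p i ≠ 0)
    (hpp : ∀ i j, i ≠ j → ∀ a : k, p i ≠ a • p j) (K : ℕ)
    (I : Ideal (MvPolynomial (Fin (n+1)) k))
    (hhom : I.IsHomogeneous (homogeneousSubmodule (Fin (n+1)) k))
    (hI : ∀ f, f ∈ I ↔ ∀ i, f ∈ lineIdeal (p i)) :
    ∃ D : ℕ, ∀ d ≥ D, hilb k n (I ^ (K+1)) d ≤ Fintype.card ι * (n + K).choose n := by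
  classical
  obtain ⟨D, e, he⟩ := exists_sep p hp hpp
  choose l hl hlp using fun i => exists_linear_one (hp i)
  set N := D * (K+1) with hN
  have hEh : ∀ i, (e i ^ (K+1)).IsHomogeneous N := fun i => (he i).1.pow (K+1)
  have hep : ∀ i, Ideal.span {e i} * lineIdeal (p i) ≤ I := by
    intro i
    rw [Ideal.span_singleton_mul_le_iff]
    intro f hf
    rw [hI]
    intro j
    by_cases hij : j = i
    · subst hij; exact Ideal.mul_mem_left _ _ hf
    · exact Ideal.mul_mem_right _ _ (mem_lineIdeal_of_hom (he i).1 ((he i).2.2 j hij))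
  have hEp : ∀ i, ∀ f ∈ lineIdeal (p i) ^ (K+1), e i ^ (K+1) * f ∈ I ^ (K+1) := by
    intro i f hf
    have := Ideal.pow_right_mono (hep i) (K+1)
    rw [mul_pow, Ideal.span_singleton_pow, Ideal.span_singleton_mul_le_iff] at this
    exact this f hf
  have hIh : (I ^ (K+1)).IsHomogeneous (homogeneousSubmodule (Fin (n+1)) k) := by
    generalize K + 1 = m
    induction m with
    | zero => rw [pow_zero, Ideal.one_eq_top]; exact Ideal.IsHomogeneous.top _
    | succ m ih => rw [pow_succ]; exact ih.mul hhom
  set A : Ideal (MvPolynomial (Fin (n+1)) k) := Ideal.span (Set.range fun i => e i ^ (K+1)) with hA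
  have h1 : idealOfVars (Fin (n+1)) k ^ N ≤ A ⊔ I := by
    rw [pow_idealOfVars_eq_span, Ideal.span_le]
    rintro _ ⟨m, hm, rfl⟩
    have hmh : (monomial m (1:k)).IsHomogeneous N := isHomogeneous_monomial _ hm
    set f := monomial m (1:k) with hf
    have e1 : f = (∑ i, C (eval (p i) f) * e i ^ (K+1)) +
      (f - ∑ i, C (eval (p i) f) * e i ^ (K+1)) := by ring
    change f ∈ A ⊔ I
    rw [e1]
    refine Submodule.add_mem_sup (sum_mem fun i _ => Ideal.mul_mem_left _ _
      (Ideal.subset_span ⟨i, rfl⟩)) ?_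
    rw [hI]
    intro j
    refine mem_lineIdeal_of_hom (d := N)
      (hmh.sub (IsHomogeneous.sum _ _ _ fun i _ => (hEh i).C_mul _)) ?_
    rw [map_sub, map_sum, Finset.sum_eq_single j]
    · simp [(he j).2.1]
    · intro i _ hij
      simp [(he i).2.2 j hij.symm]
    · simp
  have h2 : idealOfVars (Fin (n+1)) k ^ (N * (K+1)) ≤ A ⊔ I ^ (K+1) := by
    rw [pow_mul]
    exact (Ideal.pow_right_mono h1 _).trans (sup_pow_le _ _ _)
  refine ⟨N * (K+1) + N + K, fun d hd => ?_⟩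
  obtain ⟨s, hs⟩ : ∃ s, d = s + K + N := ⟨d - N - K, by omega⟩
  set u : ι → MvPolynomial (Fin (n+1)) k := fun i => e i ^ (K+1) * l i ^ s with hu
  rw [← finrank_dom (k := k) K]
  refine le_trans ?_ (LinearMap.finrank_range_le (param (I ^ (K+1)) u K))
  unfold hilb
  refine Submodule.finrank_mono ?_
  rintro _ ⟨f, hf, rfl⟩
  rw [SetLike.mem_coe, mem_homogeneousSubmodule] at hf
  have hfA : f ∈ A ⊔ I ^ (K+1) := by
    apply h2
    rw [mem_pow_idealOfVars_iff']
    intro x hx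
    exact hf.coeff_eq_zero (by omega)
  obtain ⟨a, ha, b, hb, hab⟩ := Submodule.mem_sup.mp hfA
  rw [hA, Ideal.mem_span_range_iff_exists_fun] at ha
  obtain ⟨c, rfl⟩ := ha
  have hfd : f = ∑ i, homogeneousComponent (s + K) (c i) * e i ^ (K+1) +
      homogeneousComponent d b := by
    conv_lhs => rw [← homogeneousComponent_eq_self hf, ← hab, map_add, map_sum, hs]
    rw [hs]
    congr 1
    exact Finset.sum_congr rfl fun i _ => hcomp_mul (hEh i) _
  choose g hg hgm using fun i => exists_sub_mem (hl i) (hlp i) (s + K) s K rfl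
    (homogeneousComponent (s + K) (c i)) (homogeneousComponent_isHomogeneous _ _)
  refine ⟨fun i => ⟨g i, hg i⟩, ?_⟩
  rw [param_apply]
  change _ = Ideal.Quotient.mk _ f
  rw [eq_comm, Ideal.Quotient.eq]
  have : f - ∑ i, u i * g i = (∑ i, e i ^ (K+1) *
      (homogeneousComponent (s + K) (c i) - l i ^ s * g i)) + homogeneousComponent d b := by
    rw [hfd, add_sub_right_comm, ← Finset.sum_sub_distrib]
    congr 1
    refine Finset.sum_congr rfl fun i _ => ?_
    simp only [hu]; ring
  rw [this]
  exact add_mem (sum_mem fun i _ => hEp i _ (hgm i)) (homogeneousComponent_mem_of_mem hIh hb d)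

lemma cone {I : Ideal (MvPolynomial (Fin (n+1)) k)}
    (hhom : I.IsHomogeneous (homogeneousSubmodule (Fin (n+1)) k)) {x : Fin (n+1) → k}
    (hx : ∀ f ∈ I, eval x f = 0) (t : k) : ∀ f ∈ I, eval (t • x) f = 0 := by
  intro f hf
  rw [← sum_homogeneousComponent f, map_sum]
  refine Finset.sum_eq_zero fun i _ => ?_
  rw [eval_smul_hom (homogeneousComponent_isHomogeneous i f),
    hx _ (homogeneousComponent_mem_of_mem hhom hf i), mul_zero]

lemma rep_ne {x y : Projectivization k (Fin (n+1) → k)} (h : x ≠ y) (a : k) :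
    x.rep ≠ a • y.rep := by
  intro he
  apply h
  rw [← x.mk_rep, ← y.mk_rep, Projectivization.mk_eq_mk_iff']
  exact ⟨a, he.symm⟩

theorem main [IsAlgClosed k] (I : Ideal (MvPolynomial (Fin (n+1)) k))
    (hhom : I.IsHomogeneous (homogeneousSubmodule (Fin (n+1)) k))
    (hrad : I.IsRadical) (r : ℕ) (hr : 0 < r)
    (hH : ∃ D : ℕ, ∀ d ≥ D, hilb k n I d = r) (K : ℕ) :
    ∃ D : ℕ, ∀ d ≥ D, hilb k n (I ^ (K+1)) d = r * (n + K).choose n := by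
  classical
  have : Infinite k := IsAlgClosed.instInfinite
  obtain ⟨D₀, hD₀⟩ := hH
  have hnull : ∀ f, (∀ x : Fin (n+1) → k, (∀ g ∈ I, eval x g = 0) → eval x f = 0) → f ∈ I := by
    intro f hf
    have h := vanishingIdeal_zeroLocus_eq_radical (K := k) I
    rw [hrad.radical] at h
    rw [← h, mem_vanishingIdeal_iff]
    intro x hx
    simp only [mem_zeroLocus_iff, aeval_eq_eval] at hx ⊢
    exact hf x hx
  set Z : Set (Projectivization k (Fin (n+1) → k)) := {x | ∀ f ∈ I, eval x.rep f = 0} with hZ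
  have hIle : ∀ x ∈ Z, I ≤ lineIdeal x.rep := fun x hx f hf t => cone hhom hx t f hf
  have hfin : Z.Finite := by
    by_contra hinf
    obtain ⟨T, hT, hcard⟩ := Set.Infinite.exists_subset_card_eq hinf (r+1)
    obtain ⟨D, hD⟩ := lower (fun i : T => i.1.rep) (fun i => i.1.rep_nonzero)
      (fun i j hij a => rep_ne (fun h => hij (Subtype.ext h)) a) 0 I
      (fun i => by simpa using hIle i.1 (hT i.2))
    have h1 := hD (max D D₀) (le_max_left _ _)
    rw [hD₀ _ (le_max_right _ _)] at h1
    simp [hcard] at h1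
  have : Fintype Z := hfin.fintype
  have hI : ∀ f, f ∈ I ↔ ∀ i : Z, f ∈ lineIdeal i.1.rep := by
    have hne : Z.Nonempty := by
      by_contra hne
      rw [Set.not_nonempty_iff_eq_empty] at hne
      have h1 := hD₀ (D₀ + 1) (by omega)
      have h2 : (homogeneousSubmodule (Fin (n+1)) k (D₀ + 1)).map
          (Ideal.Quotient.mkₐ k I).toLinearMap = ⊥ := by
        rw [eq_bot_iff]
        rintro _ ⟨f, hf, rfl⟩
        rw [SetLike.mem_coe, mem_homogeneousSubmodule] at hf
        rw [Submodule.mem_bot]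
        change Ideal.Quotient.mk I f = 0
        rw [Ideal.Quotient.eq_zero_iff_mem]
        refine hnull f fun x hx => ?_
        by_cases hx0 : x = 0
        · have := eval_smul_hom hf 0 x
          simpa [hx0] using this
        · exfalso
          have : Projectivization.mk k x hx0 ∈ Z := by
            obtain ⟨a, ha⟩ := Projectivization.exists_smul_eq_mk_rep k x hx0
            intro g hg
            rw [← ha]
            exact cone hhom hx (a : k) g hg
          rw [hne] at this
          exact this
      unfold hilb at h1
      rw [h2, finrank_bot] at h1
      omega
    intro f
    refine ⟨fun hf i => hIle i.1 i.2 hf, fun hf => hnull f fun x hx => ?_⟩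
    by_cases hx0 : x = 0
    · obtain ⟨z, hz⟩ := hne
      have := hf ⟨z, hz⟩ 0
      rw [zero_smul] at this
      rwa [hx0]
    · obtain ⟨a, ha⟩ := Projectivization.exists_smul_eq_mk_rep k x hx0
      have hm : Projectivization.mk k x hx0 ∈ Z := by
        intro g hg
        rw [← ha]
        exact cone hhom hx (a : k) g hg
      have h1 := hf ⟨_, hm⟩ ((a⁻¹ : kˣ) : k)
      rw [← ha] at h1
      have h2 : ((a⁻¹ : kˣ) : k) • a • x = x := by
        rw [← Units.smul_def, inv_smul_smul]
      rwa [h2] at h1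
  have hall : ∀ K, ∃ D : ℕ, ∀ d ≥ D,
      hilb k n (I ^ (K+1)) d = Fintype.card Z * (n + K).choose n := by
    intro K
    have hp : ∀ i : Z, i.1.rep ≠ 0 := fun i => i.1.rep_nonzero
    have hpp : ∀ i j : Z, i ≠ j → ∀ a : k, i.1.rep ≠ a • j.1.rep :=
      fun i j hij a => rep_ne (fun h => hij (Subtype.ext h)) a
    obtain ⟨D₁, h1⟩ := lower (fun i : Z => i.1.rep) hp hpp K (I ^ (K+1))
      (fun i => Ideal.pow_right_mono (hIle i.1 i.2) _)
    obtain ⟨D₂, h2⟩ := upper (fun i : Z => i.1.rep) hp hpp K I hhom hI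
    exact ⟨max D₁ D₂, fun d hd => le_antisymm (h2 d (le_of_max_le_right hd))
      (h1 d (le_of_max_le_left hd))⟩
  have hcard : Fintype.card Z = r := by
    obtain ⟨D, hD⟩ := hall 0
    have h1 := hD (max D D₀) (le_max_left _ _)
    rw [zero_add, pow_one, hD₀ _ (le_max_right _ _)] at h1
    simpa using h1.symm
  rw [← hcard]
  exact hall K

end HilbPow

theorem hilbert_function_of_power_of_radical_ideal
    (k : Type*) [Field k] [IsAlgClosed k] (n : ℕ) (hn : 0 < n)
    (I : Ideal (MvPolynomial (Fin (n+1)) k))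
    (hhom : I.IsHomogeneous (homogeneousSubmodule (Fin (n+1)) k))
    (hrad : I.IsRadical) (r : ℕ) (hr : 0 < r)
    (hH : ∃ D : ℕ, ∀ d ≥ D, hilb k n I d = r) :
    ∀ K : ℕ, 0 < K → ∃ D : ℕ, ∀ d ≥ D, hilb k n (I ^ K) d = r * (n + K - 1).choose n := by
  intro K hK
  obtain ⟨K, rfl⟩ : ∃ m, K = m + 1 := ⟨K - 1, by omega⟩
  exact HilbPow.main I hhom hrad r hr hH K
end

section
/- Let r and k be positive integers and let I ⊆ S = k[α_0,…,α_n] be a homogeneous radical ideal such that dim_k (S/I)_a = r for all sufficiently large a. Let e = min{a ∈ ℤ : dim_k (S/I)_a = r}. Then for every integer d ≥ ke + k one has dim_k (S/I^k)_d = r · C(n+k−1, n), where C(n+k−1, n) = dim_k S_{k−1}. -/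
open MvPolynomial

attribute [local instance] MvPolynomial.gradedAlgebra

namespace HilbPow

/-! ### Generic lemmas on homogeneous polynomials -/

lemma comp_mul {k σ : Type*} [Field k] {a m : ℕ} {u : MvPolynomial σ k} (hu : u.IsHomogeneous a)
    (h : MvPolynomial σ k) :
    homogeneousComponent (a + m) (u * h) = u * homogeneousComponent m h := by
  conv_lhs => rw [← sum_homogeneousComponent h, Finset.mul_sum, map_sum]
  have : ∀ i, homogeneousComponent (a + m) (u * homogeneousComponent i h)
      = if m = i then u * homogeneousComponent i h else 0 := by
    intro i
    rw [homogeneousComponent_of_mem (hu.mul (homogeneousComponent_isHomogeneous i h))]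
    simp
  simp only [this]
  rw [Finset.sum_ite_eq]
  split_ifs with hm
  · rfl
  · rw [homogeneousComponent_eq_zero, mul_zero]
    simpa using hm

lemma exists_X_decomp {k σ : Type*} [Field k] [Fintype σ] {m : ℕ} {f : MvPolynomial σ k}
    (hf : f.IsHomogeneous (m + 1)) :
    ∃ g : σ → MvPolynomial σ k, (∀ s, (g s).IsHomogeneous m) ∧ f = ∑ s, X s * g s := by
  have hf' : f ∈ homogeneousSubmodule σ k 1 * homogeneousSubmodule σ k m := by
    rw [← homogeneousSubmodule_one_pow (σ := σ) (R := k) (n := m), ← pow_succ', homogeneousSubmodule_one_pow]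
    exact hf
  induction hf' using Submodule.mul_induction_on' with
  | mem_mul_mem a ha b hb =>
    rw [homogeneousSubmodule_one_eq_span_X, Submodule.mem_span_range_iff_exists_fun] at ha
    obtain ⟨c, rfl⟩ := ha
    refine ⟨fun s => C (c s) * b, fun s => hb.C_mul _, ?_⟩
    rw [Finset.sum_mul]
    refine Finset.sum_congr rfl fun s _ => ?_
    rw [smul_eq_C_mul]; ring
  | add x hx y hy h1 h2 =>
    have key : ∀ z ∈ homogeneousSubmodule σ k 1 * homogeneousSubmodule σ k m,
        z.IsHomogeneous (m + 1) := by
      intro z hz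
      rw [add_comm]
      exact homogeneousSubmodule_mul 1 m hz
    obtain ⟨g, hg, rfl⟩ := h1 (key _ hx)
    obtain ⟨g', hg', rfl⟩ := h2 (key _ hy)
    refine ⟨fun s => g s + g' s, fun s => (hg s).add (hg' s), ?_⟩
    rw [← Finset.sum_add_distrib]
    exact Finset.sum_congr rfl fun s _ => by ring

lemma exists_span_decomp {k σ ι : Type*} [Field k] [Fintype ι] {m a : ℕ} {f : MvPolynomial σ k}
    (hf : f.IsHomogeneous (a + m)) (ξ : ι → MvPolynomial σ k) (hξ : ∀ t, (ξ t).IsHomogeneous a)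
    (h : f ∈ Ideal.span (Set.range ξ)) :
    ∃ g : ι → MvPolynomial σ k, (∀ s, (g s).IsHomogeneous m) ∧ f = ∑ s, ξ s * g s := by
  obtain ⟨c, hc⟩ := Ideal.mem_span_range_iff_exists_fun.1 h
  refine ⟨fun s => homogeneousComponent m (c s),
    fun s => homogeneousComponent_isHomogeneous _ _, ?_⟩
  rw [← homogeneousComponent_eq_self hf, ← hc, map_sum]
  refine Finset.sum_congr rfl fun s _ => ?_
  rw [mul_comm, comp_mul (hξ s)]

lemma pow_mul_aeval_mem {k A τ : Type*} [Field k] [CommRing A] [Algebra k A] [Fintype τ]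
    (J : Ideal A)
    (x : τ → A) (y : A) (h : ∀ t, y * x t ∈ J) (j : ℕ) (P : MvPolynomial τ k)
    (hP : P.IsHomogeneous j) : y ^ j * aeval x P ∈ J ^ j := by
  induction j generalizing P with
  | zero => simp
  | succ j ih =>
    obtain ⟨g, hg, rfl⟩ := exists_X_decomp hP
    rw [map_sum, Finset.mul_sum]
    refine sum_mem fun s _ => ?_
    have : y ^ (j + 1) * aeval x (X s * g s) = (y ^ j * aeval x (g s)) * (y * x s) := by
      rw [map_mul, aeval_X]; ring
    rw [this, pow_succ]
    exact Ideal.mul_mem_mul (ih _ (hg s)) (h s)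

lemma eval_smul_homog {k σ : Type*} [Field k] {d : ℕ} {f : MvPolynomial σ k}
    (hf : f.IsHomogeneous d) (c : k) (x : σ → k) :
    eval (c • x) f = c ^ d * eval x f := by
  rw [eval_eq, eval_eq, Finset.mul_sum]
  refine Finset.sum_congr rfl fun m hm => ?_
  have hd := hf.degree_eq_sum_deg_support hm
  simp only [Pi.smul_apply, smul_eq_mul, mul_pow, Finset.prod_mul_distrib, Finset.prod_pow_eq_pow_sum]
  rw [← hd]; ring

instance finDimHomog {k σ : Type*} [Field k] [Finite σ] (d : ℕ) :
    FiniteDimensional k (homogeneousSubmodule σ k d) :=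
  Module.Finite.iff_fg.2 (homogeneousSubmodule_fg σ k d)

lemma finrank_homog (k : Type*) [Field k] (n j : ℕ) :
    Module.finrank k (homogeneousSubmodule (Fin n) k j) = n.multichoose j := by
  have h1 : homogeneousSubmodule (Fin n) k j
      = restrictSupport k {d : Fin n →₀ ℕ | d.degree = j} := homogeneousSubmodule_eq_finsupp_supported _ _ _
  rw [h1, Module.finrank_eq_nat_card_basis (basisRestrictSupport k _)]
  have h2 : {d : Fin n →₀ ℕ | d.degree = j} = ↑(Finset.finsuppAntidiag (Finset.univ : Finset (Fin n)) j) := by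
    ext d
    simp [Finset.mem_finsuppAntidiag, Finsupp.degree_eq_sum]
  rw [h2]
  rw [Nat.card_coe_set_eq, Set.ncard_coe_finset, Finset.card_finsuppAntidiag_nat_eq_multichoose]
  simp

lemma hilb_add (k : Type*) [Field k] (n : ℕ) (J : Ideal (MvPolynomial (Fin (n+1)) k)) (d : ℕ) :
    hilb k n J d + Module.finrank k
      ((homogeneousSubmodule (Fin (n+1)) k d ⊓ J.restrictScalars k : Submodule k _))
      = Module.finrank k (homogeneousSubmodule (Fin (n+1)) k d) := by
  have h := LinearMap.finrank_range_add_finrank_ker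
    ((Ideal.Quotient.mkₐ k J).toLinearMap.domRestrict (homogeneousSubmodule (Fin (n+1)) k d))
  rw [LinearMap.range_domRestrict, LinearMap.ker_domRestrict] at h
  rw [← h, hilb]
  congr 1
  rw [← Submodule.finrank_map_subtype_eq, Submodule.map_comap_subtype]
  have hk : (Ideal.Quotient.mkₐ k J).toLinearMap.ker = J.restrictScalars k := by
    ext x
    simp [Ideal.Quotient.eq_zero_iff_mem]
  rw [hk]

end HilbPow
namespace HilbPow

/-- A reduced set of points (normalised by a linear form `ℓ`) whose homogeneous ideal is `I`,
with separators `ε i` of degree `e`, local linear coordinates `ξ i t` and local expansions `τ i`. -/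
structure PtData (k : Type*) [Field k] (n : ℕ) (ι : Type*) [Fintype ι] [DecidableEq ι]
    (I : Ideal (MvPolynomial (Fin (n+1)) k)) where
  p : ι → Fin (n+1) → k
  l : MvPolynomial (Fin (n+1)) k
  e : ℕ
  ε : ι → MvPolynomial (Fin (n+1)) k
  ξ : ι → Fin n → MvPolynomial (Fin (n+1)) k
  τ : ι → MvPolynomial (Fin (n+1)) k →ₐ[k] MvPolynomial (Fin n) k
  hom : I.IsHomogeneous (homogeneousSubmodule (Fin (n+1)) k)
  hl : l.IsHomogeneous 1
  hlp : ∀ i, eval (p i) l = 1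
  inj : Function.Injective p
  mem : ∀ d f, f.IsHomogeneous d → (f ∈ I ↔ ∀ i, eval (p i) f = 0)
  hε : ∀ i, (ε i).IsHomogeneous e
  hεp : ∀ i j, eval (p j) (ε i) = if j = i then 1 else 0
  hξ : ∀ i t, (ξ i t).IsHomogeneous 1
  hξp : ∀ i t, eval (p i) (ξ i t) = 0
  hX : ∀ i s, ∃ c : Fin n → k, X s = C (p i s) * l + ∑ t, C (c t) * ξ i t
  hτl : ∀ i, τ i l = 1
  hτξ : ∀ i t, τ i (ξ i t) = X t
  hτ : ∀ i f, constantCoeff (τ i f) = eval (p i) f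

namespace PtData

variable {k : Type*} [Field k] {n : ℕ} {ι : Type*} [Fintype ι] [DecidableEq ι]
    {I : Ideal (MvPolynomial (Fin (n+1)) k)} (D : PtData k n ι I)

lemma sub_mem_span (i : ι) (m : ℕ) (f : MvPolynomial (Fin (n+1)) k) (hf : f.IsHomogeneous m) :
    f - C (eval (D.p i) f) * D.l ^ m ∈ Ideal.span (Set.range (D.ξ i)) := by
  induction m generalizing f with
  | zero =>
    rw [← totalDegree_zero_iff_isHomogeneous, totalDegree_eq_zero_iff_eq_C] at hf
    rw [hf]; simp
  | succ m ih =>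
    obtain ⟨g, hg, rfl⟩ := exists_X_decomp hf
    rw [map_sum, map_sum, Finset.sum_mul, ← Finset.sum_sub_distrib]
    refine sum_mem fun s _ => ?_
    have h1 : X s - C (D.p i s) * D.l ∈ Ideal.span (Set.range (D.ξ i)) := by
      obtain ⟨c, hc⟩ := D.hX i s
      rw [hc, add_sub_cancel_left]
      exact sum_mem fun t _ => Ideal.mul_mem_left _ _ (Ideal.subset_span ⟨t, rfl⟩)
    have : X s * g s - C (eval (D.p i) (X s * g s)) * D.l ^ (m + 1)
        = g s * (X s - C (D.p i s) * D.l)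
          + C (D.p i s) * D.l * (g s - C (eval (D.p i) (g s)) * D.l ^ m) := by
      rw [map_mul, eval_X, C_mul]; ring
    rw [this]
    exact add_mem (Ideal.mul_mem_left _ _ h1) (Ideal.mul_mem_left _ _ (ih _ (hg s)))

lemma expand (i : ι) (m : ℕ) (f : MvPolynomial (Fin (n+1)) k) (hf : f.IsHomogeneous (m + 1))
    (h0 : eval (D.p i) f = 0) :
    ∃ g : Fin n → MvPolynomial (Fin (n+1)) k, (∀ t, (g t).IsHomogeneous m) ∧
      f = ∑ t, D.ξ i t * g t := by
  have h := D.sub_mem_span i _ f hf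
  rw [h0] at h
  rw [add_comm m 1] at hf
  exact exists_span_decomp hf (D.ξ i) (D.hξ i) (by simpa using h)

lemma homog_interp (a : ι → k) (c : ℕ) :
    (∑ i, C (a i) * (D.ε i * D.l ^ c)).IsHomogeneous (D.e + c) := by
  refine IsHomogeneous.sum _ _ _ fun i _ => ?_
  have := (D.hl.pow c)
  rw [one_mul] at this
  exact ((D.hε i).mul this).C_mul _

lemma eval_interp (a : ι → k) (c : ℕ) (j : ι) :
    eval (D.p j) (∑ i, C (a i) * (D.ε i * D.l ^ c)) = a j := by
  simp [D.hεp, D.hlp]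

lemma interp (c : ℕ) (f : MvPolynomial (Fin (n+1)) k) (hf : f.IsHomogeneous (D.e + c)) :
    f - ∑ i, C (eval (D.p i) f) * (D.ε i * D.l ^ c) ∈ I := by
  rw [D.mem _ _ (hf.sub (D.homog_interp _ c))]
  intro i
  rw [map_sub, D.eval_interp, sub_self]

/-- The ideal generated by the degree `e+1` piece. -/
noncomputable def Q : Ideal (MvPolynomial (Fin (n+1)) k) :=
  Ideal.span {v | v ∈ I ∧ v.IsHomogeneous (D.e + 1)}

lemma mem_Q (c : ℕ) (f : MvPolynomial (Fin (n+1)) k) (hf : f.IsHomogeneous (D.e + 1 + c))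
    (hI : f ∈ I) : f ∈ D.Q := by
  induction c generalizing f with
  | zero => exact Ideal.subset_span ⟨hI, hf⟩
  | succ c ih =>
    obtain ⟨g, hg, hfg⟩ := exists_X_decomp (m := D.e + 1 + c) hf
    set g' : Fin (n+1) → MvPolynomial (Fin (n+1)) k :=
      fun s => ∑ i, C (eval (D.p i) (g s)) * (D.ε i * D.l ^ c) with hg'
    have hu : ∀ s, g s - D.l * g' s ∈ I := by
      intro s
      have := D.interp (c + 1) (g s) (by convert hg s using 1; ring)
      convert this using 2
      rw [hg', Finset.mul_sum]
      exact Finset.sum_congr rfl fun i _ => by ring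
    have hlg' : ∀ s, (D.l * g' s).IsHomogeneous (D.e + 1 + c) := by
      intro s
      have := D.hl.mul (D.homog_interp (fun i => eval (D.p i) (g s)) c)
      convert this using 1; ring
    have huQ : ∀ s, g s - D.l * g' s ∈ D.Q := fun s => ih _ ((hg s).sub (hlg' s)) (hu s)
    have hh : (∑ s, X s * g' s).IsHomogeneous (D.e + 1 + c) := by
      refine IsHomogeneous.sum _ _ _ fun s _ => ?_
      have := (isHomogeneous_X k s).mul (D.homog_interp (fun i => eval (D.p i) (g s)) c)
      convert this using 1; ring
    have hf2 : f = ∑ s, X s * (g s - D.l * g' s) + D.l * ∑ s, X s * g' s := by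
      rw [hfg, Finset.mul_sum, ← Finset.sum_add_distrib]
      exact Finset.sum_congr rfl fun i _ => by ring
    have hhI : ∑ s, X s * g' s ∈ I := by
      rw [D.mem _ _ hh]
      intro i
      have h1 := (D.mem _ _ hf).1 hI i
      have h2 : ∀ s, eval (D.p i) (g s - D.l * g' s) = 0 := fun s =>
        (D.mem _ _ ((hg s).sub (hlg' s))).1 (hu s) i
      rw [hf2, map_add, map_sum, map_mul, D.hlp, one_mul] at h1
      simpa [h2] using h1
    rw [hf2]
    exact add_mem (sum_mem fun s _ => Ideal.mul_mem_left _ _ (huQ s))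
      (Ideal.mul_mem_left _ _ (ih _ hh hhI))

lemma pow_hom (D : PtData k n ι I) (j : ℕ) : (I ^ j).IsHomogeneous (homogeneousSubmodule (Fin (n+1)) k) := by
  induction j with
  | zero => rw [pow_zero, Ideal.one_eq_top]; exact Ideal.IsHomogeneous.top _
  | succ j ih => rw [pow_succ]; exact ih.mul D.hom

lemma comp_mem (j d : ℕ) (hd : (j + 1) * (D.e + 1) ≤ d) (x : MvPolynomial (Fin (n+1)) k)
    (hx : x ∈ I ^ (j + 1)) : homogeneousComponent d x ∈ D.Q * I ^ j := by
  induction j generalizing d x with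
  | zero =>
    obtain ⟨c, rfl⟩ := Nat.exists_eq_add_of_le hd
    rw [pow_zero, mul_one]
    refine D.mem_Q c _ ?_ ?_
    · convert homogeneousComponent_isHomogeneous _ _ using 1; ring
    · exact homogeneousComponent_mem_of_mem D.hom (by simpa using hx) _
  | succ j ih =>
    rw [pow_succ'] at hx
    induction hx using Submodule.mul_induction_on' with
    | add x _ y _ h1 h2 => rw [map_add]; exact add_mem h1 h2
    | mem_mul_mem a ha b hb =>
      rw [← sum_homogeneousComponent a, Finset.sum_mul, map_sum]
      refine sum_mem fun q _ => ?_
      by_cases hq : q ≤ d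
      · obtain ⟨c, rfl⟩ := Nat.exists_eq_add_of_le hq
        rw [comp_mul (homogeneousComponent_isHomogeneous q a)]
        have hqI := homogeneousComponent_mem_of_mem D.hom ha q
        by_cases hqe : D.e + 1 ≤ q
        · obtain ⟨c', rfl⟩ := Nat.exists_eq_add_of_le hqe
          exact Ideal.mul_mem_mul (D.mem_Q c' _ (homogeneousComponent_isHomogeneous _ _) hqI)
            (homogeneousComponent_mem_of_mem (D.pow_hom _) hb _)
        · have := ih c (by nlinarith) b hb
          rw [pow_succ', mul_left_comm]
          exact Ideal.mul_mem_mul hqI this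
      · have : homogeneousComponent d (homogeneousComponent q a * b) = 0 := by
          rw [← sum_homogeneousComponent b, Finset.mul_sum, map_sum]
          refine Finset.sum_eq_zero fun i _ => ?_
          rw [homogeneousComponent_of_mem ((homogeneousComponent_isHomogeneous q a).mul
            (homogeneousComponent_isHomogeneous i b)), if_neg (by omega)]
        rw [this]; exact zero_mem _

end PtData

end HilbPow
namespace HilbPow
namespace PtData

variable {k : Type*} [Field k] {n : ℕ} {ι : Type*} [Fintype ι] [DecidableEq ι]
    {I : Ideal (MvPolynomial (Fin (n+1)) k)} (D : PtData k n ι I)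

lemma lin_mul_mem (i : ι) (N : MvPolynomial (Fin (n+1)) k) (hN : N.IsHomogeneous 1)
    (h0 : eval (D.p i) N = 0) : N * D.ε i ∈ I := by
  rw [D.mem _ _ (hN.mul (D.hε i))]
  intro j
  rw [map_mul, D.hεp]
  split_ifs with h
  · rw [h, h0, zero_mul]
  · rw [mul_zero]

lemma exists_sep (i j : ι) (h : i ≠ j) : ∃ N : MvPolynomial (Fin (n+1)) k, N.IsHomogeneous 1 ∧
    eval (D.p i) N = 0 ∧ eval (D.p j) N = 1 := by
  obtain ⟨s, hs⟩ := Function.ne_iff.1 (D.inj.ne h)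
  refine ⟨C (D.p j s - D.p i s)⁻¹ * (X s - C (D.p i s) * D.l),
    ((isHomogeneous_X k s).sub (D.hl.C_mul _)).C_mul _, ?_, ?_⟩
  · simp [D.hlp]
  · simp only [map_mul, map_sub, eval_C, eval_X, D.hlp, mul_one]
    exact inv_mul_cancel₀ (sub_ne_zero.2 (Ne.symm hs))

lemma double_mem (i : ι) (h : Fin n → MvPolynomial (Fin (n+1)) k)
    (hh : ∀ t, (h t).IsHomogeneous D.e) (h0 : ∀ t, eval (D.p i) (h t) = 0)
    (hI : ∑ t, D.ξ i t * h t ∈ I) :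
    (∑ t, D.ξ i t * h t) * (D.ε i * D.l) ∈ I ^ 2 := by
  have hq : ∀ t, h t - ∑ j, C (eval (D.p j) (h t)) * D.ε j ∈ I := by
    intro t
    simpa using D.interp 0 (h t) (hh t)
  have hhom : (∑ t, D.ξ i t * h t).IsHomogeneous (1 + D.e) :=
    IsHomogeneous.sum _ _ _ fun t _ => (D.hξ i t).mul (hh t)
  have hev := (D.mem _ _ hhom).1 hI
  set Lf : ι → MvPolynomial (Fin (n+1)) k := fun j => ∑ t, C (eval (D.p j) (h t)) * D.ξ i t with hLf
  have hLhom : ∀ j, (Lf j).IsHomogeneous 1 := fun j =>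
    IsHomogeneous.sum _ _ _ fun t _ => (D.hξ i t).C_mul _
  have hLi : ∀ j, eval (D.p i) (Lf j) = 0 := by
    intro j; simp [hLf, D.hξp]
  have hLj : ∀ j, eval (D.p j) (Lf j) = 0 := by
    intro j
    rw [← hev j]
    simp [hLf, mul_comm]
  have key : (∑ t, D.ξ i t * h t) * (D.ε i * D.l) =
      ∑ t, D.l * ((D.ξ i t * D.ε i) * (h t - ∑ j, C (eval (D.p j) (h t)) * D.ε j))
      + ∑ j, D.ε i * D.ε j * D.l * Lf j := by
    have : ∑ j, D.ε i * D.ε j * D.l * Lf j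
        = ∑ t, D.l * ((D.ξ i t * D.ε i) * ∑ j, C (eval (D.p j) (h t)) * D.ε j) := by
      simp only [hLf, Finset.mul_sum]
      rw [Finset.sum_comm]
      exact Finset.sum_congr rfl fun t _ => Finset.sum_congr rfl fun j _ => by ring
    rw [this, ← Finset.sum_add_distrib, Finset.sum_mul]
    exact Finset.sum_congr rfl fun t _ => by ring
  rw [key, pow_two]
  refine add_mem (sum_mem fun t _ => Ideal.mul_mem_left _ _ (Ideal.mul_mem_mul
    (D.lin_mul_mem i _ (D.hξ i t) (D.hξp i t)) (hq t))) (sum_mem fun j _ => ?_)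
  by_cases hij : i = j
  · have : Lf j = 0 := by
      rw [hLf, ← hij]; simp [h0]
    rw [this, mul_zero]; exact zero_mem _
  · obtain ⟨N, hN, hNi, hNj⟩ := D.exists_sep i j hij
    have : D.ε i * D.ε j * D.l * Lf j
        = (N * D.ε i) * (Lf j * D.ε j) + (Lf j * D.ε i) * ((D.l - N) * D.ε j) := by ring
    rw [this]
    refine add_mem (Ideal.mul_mem_mul (D.lin_mul_mem i N hN hNi)
      (D.lin_mul_mem j _ (hLhom j) (hLj j)))
      (Ideal.mul_mem_mul (D.lin_mul_mem i _ (hLhom j) (hLi j))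
        (D.lin_mul_mem j _ (D.hl.sub hN) (by rw [map_sub, D.hlp, hNj, sub_self])))

lemma exists_lead (i : ι) (v : MvPolynomial (Fin (n+1)) k) (hv : v.IsHomogeneous (D.e + 1))
    (hI : v ∈ I) : ∃ a : Fin n → k,
      (v - (∑ t, C (a t) * D.ξ i t) * D.ε i) * (D.ε i * D.l) ∈ I ^ 2 := by
  obtain ⟨g, hg, hvg⟩ := D.expand i _ v hv ((D.mem _ _ hv).1 hI i)
  refine ⟨fun t => eval (D.p i) (g t), ?_⟩
  have h1 : v - (∑ t, C (eval (D.p i) (g t)) * D.ξ i t) * D.ε i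
      = ∑ t, D.ξ i t * (g t - C (eval (D.p i) (g t)) * D.ε i) := by
    rw [hvg, Finset.sum_mul, ← Finset.sum_sub_distrib]
    exact Finset.sum_congr rfl fun t _ => by ring
  rw [h1]
  refine D.double_mem i _ (fun t => (hg t).sub ((D.hε i).C_mul _)) (fun t => ?_) ?_
  · simp [D.hεp]
  · rw [← h1, Finset.sum_mul]
    refine sub_mem hI (sum_mem fun t _ => ?_)
    rw [mul_assoc]
    exact Ideal.mul_mem_left _ _ (D.lin_mul_mem i _ (D.hξ i t) (D.hξp i t))

/-- The map producing representatives of `I^j / I^(j+1)` in a given degree. -/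
noncomputable def W (j c : ℕ) :
    (ι → homogeneousSubmodule (Fin n) k j) →ₗ[k] MvPolynomial (Fin (n+1)) k :=
  ∑ i, (LinearMap.mulLeft k (D.ε i ^ (j + 1) * D.l ^ c)) ∘ₗ (aeval (D.ξ i)).toLinearMap ∘ₗ
    (homogeneousSubmodule (Fin n) k j).subtype ∘ₗ LinearMap.proj i

lemma W_apply (j c : ℕ) (P : ι → homogeneousSubmodule (Fin n) k j) :
    D.W j c P = ∑ i, D.ε i ^ (j + 1) * D.l ^ c * aeval (D.ξ i) (P i : MvPolynomial (Fin n) k) := by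
  simp [W, mul_assoc]

lemma eps_pow_mem (i : ι) (j : ℕ) (P : homogeneousSubmodule (Fin n) k j) :
    D.ε i ^ j * aeval (D.ξ i) (P : MvPolynomial (Fin n) k) ∈ I ^ j := by
  obtain ⟨P, hP⟩ := P
  have h : ∀ t, D.ε i * D.ξ i t ∈ I := fun t => by
    rw [mul_comm]; exact D.lin_mul_mem i _ (D.hξ i t) (D.hξp i t)
  have hP' : P.IsHomogeneous j := hP
  exact pow_mul_aeval_mem I (D.ξ i) (D.ε i) h j P hP'

lemma W_mem (j c : ℕ) (P : ι → homogeneousSubmodule (Fin n) k j) : D.W j c P ∈ I ^ j := by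
  rw [W_apply]
  refine sum_mem fun i _ => ?_
  have : D.ε i ^ (j + 1) * D.l ^ c * aeval (D.ξ i) (P i : MvPolynomial (Fin n) k)
    = (D.ε i * D.l ^ c) * (D.ε i ^ j * aeval (D.ξ i) (P i : MvPolynomial (Fin n) k)) := by ring
  rw [this]
  exact Ideal.mul_mem_left _ _ (D.eps_pow_mem i j (P i))

lemma W_hom (j c : ℕ) (P : ι → homogeneousSubmodule (Fin n) k j) :
    (D.W j c P).IsHomogeneous (c + j + (j + 1) * D.e) := by
  rw [W_apply]
  refine IsHomogeneous.sum _ _ _ fun i _ => ?_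
  have h1 := ((D.hε i).pow (j + 1)).mul (D.hl.pow c)
  have h2 : (P i : MvPolynomial (Fin n) k).IsHomogeneous j := (P i).2
  have := h1.mul (h2.aeval (D.ξ i) (D.hξ i))
  convert this using 1; ring

lemma spanning (j c : ℕ) (f : MvPolynomial (Fin (n+1)) k)
    (hf : f.IsHomogeneous (c + 1 + j + (j + 1) * D.e)) (hI : f ∈ I ^ j) :
    ∃ P, D.W j (c + 1) P - f ∈ I ^ (j + 1) := by
  induction j generalizing f with
  | zero =>
    refine ⟨fun i => ⟨C (eval (D.p i) f), isHomogeneous_C _ _⟩, ?_⟩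
    have := D.interp (c + 1) f (by convert hf using 1; ring)
    rw [← neg_mem_iff, neg_sub, zero_add, pow_one]
    convert this using 2
    rw [W_apply]
    refine Finset.sum_congr rfl fun i _ => ?_
    simp only [zero_add, pow_one, aeval_C, algebraMap_eq]
    ring
  | succ j ih =>
    set d := c + 1 + (j + 1) + (j + 1 + 1) * D.e with hd
    have hx := D.comp_mem j d (by rw [hd]; nlinarith) f hI
    rw [homogeneousComponent_eq_self hf] at hx
    suffices H : ∀ x ∈ D.Q * I ^ j,
        ∃ P, D.W (j + 1) (c + 1) P - homogeneousComponent d x ∈ I ^ (j + 1 + 1) by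
      have := H f hx
      rwa [homogeneousComponent_eq_self hf] at this
    have hadd : ∀ x y, (∃ P, D.W (j + 1) (c + 1) P - homogeneousComponent d x ∈ I ^ (j + 1 + 1)) →
        (∃ P, D.W (j + 1) (c + 1) P - homogeneousComponent d y ∈ I ^ (j + 1 + 1)) →
        (∃ P, D.W (j + 1) (c + 1) P - homogeneousComponent d (x + y) ∈ I ^ (j + 1 + 1)) := by
      rintro x y ⟨P, hP⟩ ⟨P', hP'⟩
      refine ⟨P + P', ?_⟩
      rw [map_add, map_add, add_sub_add_comm]
      exact add_mem hP hP'
    intro x hx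
    induction hx using Submodule.mul_induction_on' with
    | add x _ y _ h1 h2 => exact hadd x y h1 h2
    | mem_mul_mem a ha b hb =>
      induction ha using Submodule.span_induction generalizing b with
      | zero => exact ⟨0, by simp⟩
      | add x y _ _ h1 h2 => rw [add_mul]; exact hadd _ _ (h1 b hb) (h2 b hb)
      | smul r x _ h1 =>
        have := h1 (r * b) (Ideal.mul_mem_left _ _ hb)
        rwa [smul_eq_mul, mul_assoc, mul_left_comm]
      | mem v hv =>
        obtain ⟨hvI, hvh⟩ := hv
        have hd2 : d = (D.e + 1) + (c + 1 + j + (j + 1) * D.e) := by rw [hd]; ring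
        rw [hd2, comp_mul hvh]
        set b' := homogeneousComponent (c + 1 + j + (j + 1) * D.e) b
        obtain ⟨P', hP'⟩ := ih b' (homogeneousComponent_isHomogeneous _ _)
          (homogeneousComponent_mem_of_mem (D.pow_hom _) hb _)
        choose a ha using fun i => D.exists_lead i v hvh hvI
        have hPh : ∀ i, ((∑ t, C (a i t) * X t) * (P' i : MvPolynomial (Fin n) k)).IsHomogeneous
            (j + 1) := by
          intro i
          rw [add_comm]
          exact IsHomogeneous.mul (IsHomogeneous.sum _ _ _ fun t _ => isHomogeneous_C_mul_X _ _)
            (P' i).2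
        refine ⟨fun i => ⟨_, hPh i⟩, ?_⟩
        have key : D.W (j + 1) (c + 1) (fun i => ⟨_, hPh i⟩) - v * b' =
            v * (D.W j (c + 1) P' - b')
            - ∑ i, D.l ^ c * (((v - (∑ t, C (a i t) * D.ξ i t) * D.ε i) * (D.ε i * D.l))
              * (D.ε i ^ j * aeval (D.ξ i) (P' i : MvPolynomial (Fin n) k))) := by
          rw [mul_sub, W_apply, W_apply, Finset.mul_sum, sub_right_comm, ← Finset.sum_sub_distrib]
          congr 1
          refine Finset.sum_congr rfl fun i _ => ?_
          simp only [map_mul, map_sum, aeval_C, aeval_X, algebraMap_eq]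
          ring
        rw [key]
        refine sub_mem ?_ (sum_mem fun i _ => Ideal.mul_mem_left _ _ ?_)
        · rw [pow_succ' I (j + 1)]
          exact Ideal.mul_mem_mul hvI hP'
        · have : j + 1 + 1 = 2 + j := by ring
          rw [this, pow_add]
          exact Ideal.mul_mem_mul (ha i) (D.eps_pow_mem i j (P' i))

lemma mem_vars {τ : Type*} (f : MvPolynomial τ k) (h : constantCoeff f = 0) :
    f ∈ idealOfVars τ k := by
  rw [← pow_one (idealOfVars τ k), mem_pow_idealOfVars_iff']
  intro x hx
  have : x = 0 := by
    rw [← Finsupp.degree_eq_zero_iff]; omega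
  rw [this]; exact h

lemma eval_eq_zero (i : ι) (f : MvPolynomial (Fin (n+1)) k) (hf : f ∈ I) :
    eval (D.p i) f = 0 := by
  rw [← sum_homogeneousComponent f, map_sum]
  exact Finset.sum_eq_zero fun d _ => (D.mem _ _ (homogeneousComponent_isHomogeneous d f)).1
    (homogeneousComponent_mem_of_mem D.hom hf d) i

lemma W_inj (j c : ℕ) (P : ι → homogeneousSubmodule (Fin n) k j)
    (h : D.W j c P ∈ I ^ (j + 1)) : P = 0 := by
  funext i
  set M := idealOfVars (Fin n) k
  have hmap : I ≤ Ideal.comap (D.τ i) M := fun f hf => by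
    rw [Ideal.mem_comap]
    exact mem_vars _ (by rw [D.hτ, D.eval_eq_zero i f hf])
  have h1 : D.τ i (D.W j c P) ∈ M ^ (j + 1) :=
    Ideal.le_comap_pow (D.τ i) (j + 1) (Ideal.pow_right_mono hmap (j + 1) h)
  have hPi : (P i : MvPolynomial (Fin n) k).IsHomogeneous j := (P i).2
  have hPM : (P i : MvPolynomial (Fin n) k) ∈ M ^ j := by
    rw [mem_pow_idealOfVars_iff']
    exact fun x hx => hPi.coeff_eq_zero hx.ne
  have h2 : (D.τ i (D.ε i)) - 1 ∈ M := mem_vars _ (by rw [map_sub, D.hτ, D.hεp]; simp)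
  have h3 : (D.τ i (D.ε i)) ^ (j + 1) - 1 ∈ M := by
    have := sub_dvd_pow_sub_pow (D.τ i (D.ε i)) 1 (j + 1)
    rw [one_pow] at this
    exact Ideal.mem_of_dvd _ this h2
  have h4 : D.τ i (D.W j c P) - ((D.τ i (D.ε i)) ^ (j + 1) - 1) * (P i : MvPolynomial (Fin n) k)
      - ∑ i' ∈ Finset.univ.erase i, (D.τ i (D.ε i')) ^ (j + 1) *
        D.τ i (aeval (D.ξ i') (P i' : MvPolynomial (Fin n) k)) = P i := by
    rw [W_apply, map_sum, ← Finset.add_sum_erase _ _ (Finset.mem_univ i)]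
    have h5 : D.τ i (aeval (D.ξ i) (P i : MvPolynomial (Fin n) k)) = P i := by
      rw [← AlgHom.comp_apply, comp_aeval]
      simp only [D.hτξ]
      exact aeval_X_left_apply _
    simp only [map_mul, map_pow, D.hτl, one_pow, mul_one, h5]
    ring
  have h6 : (P i : MvPolynomial (Fin n) k) ∈ M ^ (j + 1) := by
    rw [← h4]
    refine sub_mem (sub_mem h1 ?_) (sum_mem fun i' hi' => Ideal.mul_mem_right _ _ ?_)
    · rw [pow_succ']
      exact Ideal.mul_mem_mul h3 hPM
    · refine Ideal.pow_mem_pow (mem_vars _ ?_) _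
      rw [D.hτ, D.hεp, if_neg (Finset.ne_of_mem_erase hi').symm]
  rw [mem_pow_idealOfVars_iff'] at h6
  apply Subtype.ext
  ext x
  by_cases hx : x.degree < j + 1
  · simpa using h6 x hx
  · simpa using hPi.coeff_eq_zero (d := x) (by omega)

lemma finrank_step (j c : ℕ) :
    Module.finrank k ((homogeneousSubmodule (Fin (n+1)) k (c + 1 + j + (j + 1) * D.e)
      ⊓ (I ^ j).restrictScalars k : Submodule k _))
    = Module.finrank k ((homogeneousSubmodule (Fin (n+1)) k (c + 1 + j + (j + 1) * D.e)
      ⊓ (I ^ (j + 1)).restrictScalars k : Submodule k _))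
      + Fintype.card ι * n.multichoose j := by
  set d := c + 1 + j + (j + 1) * D.e
  set A : Submodule k (MvPolynomial (Fin (n+1)) k) :=
    homogeneousSubmodule (Fin (n+1)) k d ⊓ (I ^ j).restrictScalars k with hA
  set B : Submodule k (MvPolynomial (Fin (n+1)) k) :=
    homogeneousSubmodule (Fin (n+1)) k d ⊓ (I ^ (j + 1)).restrictScalars k with hB
  have hinj : Function.Injective (D.W j (c + 1)) := by
    rw [← LinearMap.ker_eq_bot, LinearMap.ker_eq_bot']
    intro P hP
    exact D.W_inj j (c + 1) P (by rw [hP]; exact zero_mem _)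
  have hsup : B ⊔ LinearMap.range (D.W j (c + 1)) = A := by
    apply le_antisymm
    · refine sup_le (inf_le_inf_left _ fun x hx => Ideal.pow_le_pow_right (Nat.le_succ j) hx) ?_
      rintro _ ⟨P, rfl⟩
      exact ⟨D.W_hom j (c + 1) P, D.W_mem j (c + 1) P⟩
    · rintro f ⟨hf, hfI⟩
      obtain ⟨P, hP⟩ := D.spanning j c f hf hfI
      rw [Submodule.mem_sup]
      refine ⟨f - D.W j (c + 1) P, ⟨IsHomogeneous.sub hf (D.W_hom j (c + 1) P), ?_⟩, _, ⟨P, rfl⟩,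
        sub_add_cancel _ _⟩
      rw [← neg_sub]
      exact neg_mem hP
  have hinf : B ⊓ LinearMap.range (D.W j (c + 1)) = ⊥ := by
    rw [eq_bot_iff]
    rintro _ ⟨⟨-, hI⟩, ⟨P, rfl⟩⟩
    rw [D.W_inj j (c + 1) P hI, map_zero]
    exact zero_mem _
  have : FiniteDimensional k B := Submodule.finiteDimensional_of_le (inf_le_left)
  have h := Submodule.finrank_sup_add_finrank_inf_eq B (LinearMap.range (D.W j (c + 1)))
  rw [hsup, hinf, finrank_bot, add_zero, LinearMap.finrank_range_of_inj hinj,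
    Module.finrank_pi_fintype] at h
  rw [h]
  simp [finrank_homog]

lemma finrank_pow (K d : ℕ) (hd : K * D.e + K ≤ d) :
    Module.finrank k ((homogeneousSubmodule (Fin (n+1)) k d
      ⊓ (I ^ K).restrictScalars k : Submodule k _))
      + Fintype.card ι * ∑ j ∈ Finset.range K, n.multichoose j
    = Module.finrank k (homogeneousSubmodule (Fin (n+1)) k d) := by
  induction K with
  | zero =>
    have : (I ^ 0).restrictScalars k = ⊤ := by
      rw [pow_zero, Ideal.one_eq_top]; rfl
    rw [this, inf_top_eq]; simp
  | succ K ih =>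
    rw [← ih (by nlinarith)]
    obtain ⟨c, hc⟩ := Nat.exists_eq_add_of_le hd
    have hc' : d = c + 1 + K + (K + 1) * D.e := by rw [hc]; ring
    rw [hc', D.finrank_step K c, Finset.sum_range_succ]
    ring

lemma hilb_pow (K d : ℕ) (hK : 0 < K) (hd : K * D.e + K ≤ d) :
    hilb k n (I ^ K) d = Fintype.card ι * (n + K - 1).choose n := by
  have h1 := hilb_add k n (I ^ K) d
  have h2 := D.finrank_pow K d hd
  obtain ⟨K, rfl⟩ := Nat.exists_eq_succ_of_ne_zero hK.ne'
  rw [Nat.succ_eq_add_one, Nat.sum_range_multichoose] at h2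
  have : n + K.succ - 1 = K + n := by omega
  rw [this]
  rw [Nat.succ_eq_add_one] at h1 ⊢
  omega

end PtData
end HilbPow
namespace HilbPow

lemma exists_coords {k : Type*} [Field k] {n : ℕ} (a p : Fin (n+1) → k)
    (l : MvPolynomial (Fin (n+1)) k) (hl : l = ∑ s, C (a s) * X s) (hlp : eval p l = 1) :
    ∃ (ξ : Fin n → MvPolynomial (Fin (n+1)) k)
      (τ : MvPolynomial (Fin (n+1)) k →ₐ[k] MvPolynomial (Fin n) k),
      (∀ t, (ξ t).IsHomogeneous 1) ∧ (∀ t, eval p (ξ t) = 0) ∧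
      (∀ s, ∃ c : Fin n → k, X s = C (p s) * l + ∑ t, C (c t) * ξ t) ∧
      τ l = 1 ∧ (∀ t, τ (ξ t) = X t) ∧ (∀ f, constantCoeff (τ f) = eval p f) := by
  have hap : ∑ s, a s * p s = 1 := by simpa [hl] using hlp
  have hlh : l.IsHomogeneous 1 := by
    rw [hl]; exact IsHomogeneous.sum _ _ _ fun t _ => isHomogeneous_C_mul_X _ _
  obtain ⟨t0, ht0⟩ : ∃ t0, a t0 ≠ 0 := by
    by_contra! h
    simp [h] at hap
  set lam : Fin (n+1) → MvPolynomial (Fin n) k :=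
    Fin.insertNth (α := fun _ => MvPolynomial (Fin n) k) t0
      (-(∑ t, C (a (t0.succAbove t) / a t0) * X t)) (fun t => X t) with hlam
  have hlam0 : lam t0 = -(∑ t, C (a (t0.succAbove t) / a t0) * X t) := by simp [hlam]
  have hlam1 : ∀ t, lam (t0.succAbove t) = X t := by intro t; simp [hlam]
  have hτl : aeval (fun s => C (p s) + lam s) l = 1 := by
    rw [hl, map_sum]
    simp only [map_mul, aeval_C, aeval_X, algebraMap_eq, mul_add, Finset.sum_add_distrib]
    have h1 : ∑ s, (C (a s) * C (p s) : MvPolynomial (Fin n) k) = 1 := by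
      simp only [← C_mul]
      rw [← map_sum, hap, C_1]
    rw [h1, Fin.sum_univ_succAbove _ t0, hlam0]
    simp only [hlam1]
    rw [mul_neg, Finset.mul_sum, add_eq_left, neg_add_eq_zero]
    refine Finset.sum_congr rfl fun t _ => ?_
    rw [← mul_assoc, ← C_mul, mul_div_cancel₀ _ ht0]
  refine ⟨fun t => X (t0.succAbove t) - C (p (t0.succAbove t)) * l,
    aeval (fun s => C (p s) + lam s), ?_, ?_, ?_, hτl, ?_, ?_⟩
  · intro t
    exact (isHomogeneous_X k _).sub (hlh.C_mul _)
  · intro t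
    simp [hlp]
  · intro s
    rcases Fin.eq_self_or_eq_succAbove t0 s with rfl | ⟨t, rfl⟩
    · refine ⟨fun t => -(a (s.succAbove t) / a s), ?_⟩
      have h2 : l = C (a s) * X s + ∑ t, C (a (s.succAbove t)) * X (s.succAbove t) := by
        rw [hl, Fin.sum_univ_succAbove _ s]
      have h3 : C (a s) * C (p s) + ∑ t, C (a (s.succAbove t)) * C (p (s.succAbove t))
          = (1 : MvPolynomial (Fin (n+1)) k) := by
        rw [Fin.sum_univ_succAbove _ s] at hap
        simp only [← C_mul, ← map_sum, ← C_add]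
        rw [hap, C_1]
      have h4 : C (a s) * C (a s)⁻¹ = (1 : MvPolynomial (Fin (n+1)) k) := by
        rw [← C_mul, mul_inv_cancel₀ ht0, C_1]
      have h5 : ∑ t, C (-(a (s.succAbove t) / a s)) *
          (X (s.succAbove t) - C (p (s.succAbove t)) * l)
          = - C (a s)⁻¹ * (∑ t, C (a (s.succAbove t)) * X (s.succAbove t)
            - (∑ t, C (a (s.succAbove t)) * C (p (s.succAbove t))) * l) := by
        rw [Finset.sum_mul, ← Finset.sum_sub_distrib, Finset.mul_sum]
        refine Finset.sum_congr rfl fun t _ => ?_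
        rw [div_eq_mul_inv, C_neg, C_mul]
        ring
      rw [h5]
      have h6 := eq_sub_of_add_eq' h3
      have h7 := eq_sub_of_add_eq' h2.symm
      rw [h6, h7]
      linear_combination (- X s + C (p s) * l) * h4
    · refine ⟨Pi.single t 1, ?_⟩
      rw [Finset.sum_eq_single t]
      · simp
      · intro b _ hb; simp [hb]
      · simp
  · intro t
    rw [map_sub, map_mul, hτl, aeval_X, aeval_C, hlam1, algebraMap_eq]
    ring
  · intro f
    have hlamc : ∀ s, constantCoeff (lam s) = 0 := by
      intro s
      rcases Fin.eq_self_or_eq_succAbove t0 s with rfl | ⟨t, rfl⟩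
      · rw [hlam0]; simp
      · rw [hlam1]; simp
    induction f using MvPolynomial.induction_on with
    | C c => simp
    | add f g hf hg => rw [map_add, map_add, map_add, hf, hg]
    | mul_X f s hf => rw [map_mul, map_mul, map_mul, hf, aeval_X]; simp [hlamc]

lemma exists_normalised {k : Type*} [Field k] [Infinite k] {n : ℕ}
    (F : Finset (Projectivization k (Fin (n+1) → k))) :
    ∃ (a : Fin (n+1) → k) (p : F → Fin (n+1) → k),
      (∀ x, eval (p x) (∑ s, C (a s) * X s) = 1) ∧ Function.Injective p ∧
      ∀ x : F, ∃ c : k, c ≠ 0 ∧ p x = c • x.1.rep := by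
  obtain ⟨f, hf⟩ := Module.exists_dual_forall_apply_ne_zero (K := k)
    (fun x : F => x.1.rep) (fun x => x.1.rep_nonzero)
  have hev : ∀ v, eval v (∑ s, C (f (Pi.single s 1)) * X s) = f v := by
    intro v
    conv_rhs => rw [pi_eq_sum_univ' v]
    simp [mul_comm, Pi.single_apply]
  refine ⟨fun s => f (Pi.single s 1), fun x => (f x.1.rep)⁻¹ • x.1.rep, ?_, ?_, ?_⟩
  · intro x
    rw [hev, map_smul, smul_eq_mul, inv_mul_cancel₀ (hf x)]
  · intro x y hxy
    apply Subtype.ext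
    rw [← x.1.mk_rep, ← y.1.mk_rep, Projectivization.mk_eq_mk_iff']
    refine ⟨f x.1.rep * (f y.1.rep)⁻¹, ?_⟩
    have hxy' : (f x.1.rep)⁻¹ • x.1.rep = (f y.1.rep)⁻¹ • y.1.rep := hxy
    rw [mul_smul, ← hxy', smul_smul, mul_inv_cancel₀ (hf x), one_smul]
  · intro x
    exact ⟨_, inv_ne_zero (hf x), rfl⟩

lemma exists_separators {k : Type*} [Field k] {n : ℕ} {ι : Type*} [Fintype ι] [DecidableEq ι]
    (p : ι → Fin (n+1) → k) (l : MvPolynomial (Fin (n+1)) k) (hl : l.IsHomogeneous 1)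
    (hlp : ∀ i, eval (p i) l = 1) (inj : Function.Injective p) (d : ℕ) (hd : Fintype.card ι ≤ d)
    (i : ι) : ∃ f : MvPolynomial (Fin (n+1)) k, f.IsHomogeneous d ∧
      ∀ j, eval (p j) f = if j = i then 1 else 0 := by
  have hsep : ∀ j, ∃ N : MvPolynomial (Fin (n+1)) k, N.IsHomogeneous 1 ∧
      eval (p i) N = 1 ∧ (j ≠ i → eval (p j) N = 0) := by
    intro j
    by_cases hij : j = i
    · exact ⟨l, hl, hlp i, fun h => absurd hij h⟩
    obtain ⟨s, hs⟩ := Function.ne_iff.1 (inj.ne hij)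
    refine ⟨C (p i s - p j s)⁻¹ * (X s - C (p j s) * l),
      ((isHomogeneous_X k s).sub (hl.C_mul _)).C_mul _, ?_, fun _ => ?_⟩
    · simp only [map_mul, map_sub, eval_C, eval_X, hlp, mul_one]
      exact inv_mul_cancel₀ (sub_ne_zero.2 (Ne.symm hs))
    · simp [hlp]
  choose N hN hNi hNj using hsep
  refine ⟨l ^ (d - Fintype.card ι) * ∏ j, N j, ?_, ?_⟩
  · have h1 := (hl.pow (d - Fintype.card ι)).mul
      (IsHomogeneous.prod Finset.univ N (fun _ => 1) fun j _ => hN j)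
    convert h1 using 1
    simp; omega
  · intro j
    split_ifs with h
    · subst h; simp [map_prod, hNi, hlp]
    · rw [map_mul, map_prod, Finset.prod_eq_zero (Finset.mem_univ j) (hNj j h), mul_zero]

/-- Evaluation at a family of points. -/
noncomputable def ev {k : Type*} [Field k] {n : ℕ} {ι : Type*} (p : ι → Fin (n+1) → k) :
    MvPolynomial (Fin (n+1)) k →ₗ[k] (ι → k) :=
  LinearMap.pi fun i => (aeval (p i)).toLinearMap

lemma ev_apply {k : Type*} [Field k] {n : ℕ} {ι : Type*} (p : ι → Fin (n+1) → k)
    (f : MvPolynomial (Fin (n+1)) k) (i : ι) : ev p f i = eval (p i) f := by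
  simp [ev, aeval_eq_eval]

lemma ev_add {k : Type*} [Field k] {n : ℕ} {ι : Type*} (p : ι → Fin (n+1) → k) (d : ℕ) :
    Module.finrank k ((homogeneousSubmodule (Fin (n+1)) k d).map (ev p)) + Module.finrank k
      ((homogeneousSubmodule (Fin (n+1)) k d ⊓ LinearMap.ker (ev p) : Submodule k _))
      = Module.finrank k (homogeneousSubmodule (Fin (n+1)) k d) := by
  have h := LinearMap.finrank_range_add_finrank_ker
    ((ev p).domRestrict (homogeneousSubmodule (Fin (n+1)) k d))
  rw [LinearMap.range_domRestrict, LinearMap.ker_domRestrict] at h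
  rw [← h]
  congr 1
  rw [← Submodule.finrank_map_subtype_eq, Submodule.map_comap_subtype]

lemma ev_le_hilb {k : Type*} [Field k] {n : ℕ} {ι : Type*} (p : ι → Fin (n+1) → k) (d : ℕ)
    (I : Ideal (MvPolynomial (Fin (n+1)) k))
    (h : ∀ f ∈ I, ∀ i, eval (p i) f = 0) :
    Module.finrank k ((homogeneousSubmodule (Fin (n+1)) k d).map (ev p)) ≤ hilb k n I d := by
  have h1 := ev_add p d
  have h2 := hilb_add k n I d
  have : FiniteDimensional k (homogeneousSubmodule (Fin (n+1)) k d ⊓ LinearMap.ker (ev p) :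
    Submodule k _) := Submodule.finiteDimensional_of_le inf_le_left
  have h3 := Submodule.finrank_mono (R := k)
    (s := homogeneousSubmodule (Fin (n+1)) k d ⊓ I.restrictScalars k)
    (t := homogeneousSubmodule (Fin (n+1)) k d ⊓ LinearMap.ker (ev p))
    (inf_le_inf_left _ fun f hf => by
      rw [LinearMap.mem_ker]; funext i; rw [ev_apply]; exact h f hf i)
  omega

lemma ev_eq_hilb {k : Type*} [Field k] {n : ℕ} {ι : Type*} (p : ι → Fin (n+1) → k) (d : ℕ)
    (I : Ideal (MvPolynomial (Fin (n+1)) k))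
    (h : ∀ f : MvPolynomial (Fin (n+1)) k, f.IsHomogeneous d → (f ∈ I ↔ ∀ i, eval (p i) f = 0)) :
    Module.finrank k ((homogeneousSubmodule (Fin (n+1)) k d).map (ev p)) = hilb k n I d := by
  have h1 := ev_add p d
  have h2 := hilb_add k n I d
  have h3 : homogeneousSubmodule (Fin (n+1)) k d ⊓ I.restrictScalars k
    = homogeneousSubmodule (Fin (n+1)) k d ⊓ LinearMap.ker (ev p) := by
    ext f
    simp only [Submodule.mem_inf, mem_homogeneousSubmodule, Submodule.restrictScalars_mem,
      LinearMap.mem_ker]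
    refine and_congr_right fun hf => ?_
    rw [h f hf, funext_iff]
    simp [ev_apply]
  rw [h3] at h2
  omega

lemma map_ev_eq_top {k : Type*} [Field k] {n : ℕ} {ι : Type*} [Fintype ι] [DecidableEq ι]
    (p : ι → Fin (n+1) → k) (l : MvPolynomial (Fin (n+1)) k) (hl : l.IsHomogeneous 1)
    (hlp : ∀ i, eval (p i) l = 1) (inj : Function.Injective p) (d : ℕ)
    (hd : Fintype.card ι ≤ d) :
    (homogeneousSubmodule (Fin (n+1)) k d).map (ev p) = ⊤ := by
  choose f hf hfe using exists_separators p l hl hlp inj d hd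
  rw [eq_top_iff]
  intro v _
  refine ⟨∑ i, C (v i) * f i, IsHomogeneous.sum _ _ _ fun i _ => (hf i).C_mul _, ?_⟩
  funext j
  rw [ev_apply]
  simp [hfe]

lemma zero_smul {k : Type*} [Field k] {n : ℕ} {I : Ideal (MvPolynomial (Fin (n+1)) k)}
    (hhom : I.IsHomogeneous (homogeneousSubmodule (Fin (n+1)) k)) (x : Fin (n+1) → k)
    (hx : ∀ f ∈ I, eval x f = 0) (c : k) : ∀ f ∈ I, eval (c • x) f = 0 := by
  intro f hf
  rw [← sum_homogeneousComponent f, map_sum]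
  refine Finset.sum_eq_zero fun d _ => ?_
  rw [eval_smul_homog (homogeneousComponent_isHomogeneous d f),
    hx _ (homogeneousComponent_mem_of_mem hhom hf d), mul_zero]

lemma exists_ptData
    (k : Type*) [Field k] [IsAlgClosed k] (n : ℕ)
    (I : Ideal (MvPolynomial (Fin (n+1)) k))
    (hhom : I.IsHomogeneous (homogeneousSubmodule (Fin (n+1)) k))
    (hrad : I.IsRadical) (r : ℕ) (hr : 0 < r)
    (hH : ∃ D : ℕ, ∀ d ≥ D, hilb k n I d = r) (e : ℕ) (he : hilb k n I e = r) :
    ∃ (F : Finset (Projectivization k (Fin (n+1) → k))) (_ : DecidableEq F) (D : PtData k n F I),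
      D.e = e ∧ Fintype.card F = r := by
  classical
  have : Infinite k := IsAlgClosed.instInfinite
  obtain ⟨D, hD⟩ := hH
  set Z : Set (Projectivization k (Fin (n+1) → k)) := {x | ∀ f ∈ I, eval x.rep f = 0} with hZ
  have hlh : ∀ a : Fin (n+1) → k, (∑ s, C (a s) * X s).IsHomogeneous 1 := fun a =>
    IsHomogeneous.sum _ _ _ fun t _ => isHomogeneous_C_mul_X _ _
  have hfin : Z.Finite := by
    by_contra hinf
    obtain ⟨F, hFZ, hF⟩ := Set.Infinite.exists_subset_card_eq hinf (r + 1)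
    obtain ⟨a, p, hp1, hpi, hpc⟩ := exists_normalised F
    have h1 := map_ev_eq_top p _ (hlh a) hp1 hpi (D + (r + 1)) (by simp [hF])
    have h2 := ev_le_hilb p (D + (r + 1)) I (by
      intro f hf x
      obtain ⟨c, hc, hx⟩ := hpc x
      rw [hx]
      exact zero_smul hhom _ (hFZ x.2) c f hf)
    rw [h1, finrank_top, hD _ (by omega)] at h2
    simp [hF] at h2
  set F := hfin.toFinset with hFdef
  obtain ⟨a, p, hp1, hpi, hpc⟩ := exists_normalised F
  have hmem1 : ∀ f ∈ I, ∀ x, eval (p x) f = 0 := by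
    intro f hf x
    obtain ⟨c, hc, hx⟩ := hpc x
    rw [hx]
    exact zero_smul hhom _ (hfin.mem_toFinset.1 x.2) c f hf
  have hmem2 : ∀ d, ∀ f : MvPolynomial (Fin (n+1)) k, f.IsHomogeneous (d + 1) →
      (∀ x, eval (p x) f = 0) → f ∈ I := by
    intro d f hf h
    have hfv : f ∈ vanishingIdeal k (zeroLocus k I) := by
      rw [mem_vanishingIdeal_iff]
      intro x hx
      rw [mem_zeroLocus_iff] at hx
      simp only [aeval_eq_eval, RingHom.coe_coe] at hx ⊢
      by_cases hx0 : x = 0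
      · have := eval_smul_homog hf 0 x
        simpa [hx0] using this
      · obtain ⟨u, hu⟩ := Projectivization.exists_smul_eq_mk_rep k x hx0
        have hy : Projectivization.mk k x hx0 ∈ F := by
          rw [hFdef, hfin.mem_toFinset, hZ, Set.mem_setOf_eq, ← hu]
          exact zero_smul hhom x hx _
        obtain ⟨c, hc, hpx⟩ := hpc ⟨_, hy⟩
        have h1 := h ⟨_, hy⟩
        rw [hpx] at h1
        simp only at h1
        rw [eval_smul_homog hf, ← hu] at h1
        have h2 : eval ((u : k) • x) f = 0 := by
          rcases mul_eq_zero.1 h1 with h | h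
          · exact absurd h (pow_ne_zero _ hc)
          · exact h
        rw [eval_smul_homog hf] at h2
        rcases mul_eq_zero.1 h2 with h | h
        · exact absurd h (pow_ne_zero _ u.ne_zero)
        · exact h
    rw [vanishingIdeal_zeroLocus_eq_radical, hrad.radical] at hfv
    exact hfv
  have hcard : Fintype.card F = r := by
    have h1 := map_ev_eq_top p _ (hlh a) hp1 hpi (D + Fintype.card F + 1) (by omega)
    have h2 := ev_eq_hilb p (D + Fintype.card F + 1) I
      (fun f hf => ⟨hmem1 f, hmem2 _ f hf⟩)
    rw [h1, finrank_top, hD _ (by omega)] at h2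
    simpa using h2
  have hmem : ∀ d, ∀ f : MvPolynomial (Fin (n+1)) k, f.IsHomogeneous d →
      (f ∈ I ↔ ∀ x, eval (p x) f = 0) := by
    intro d f hf
    refine ⟨hmem1 f, fun h => ?_⟩
    cases d with
    | succ d => exact hmem2 d f hf h
    | zero =>
      obtain ⟨x⟩ : Nonempty F := Fintype.card_pos_iff.1 (by omega)
      rw [← totalDegree_zero_iff_isHomogeneous, totalDegree_eq_zero_iff_eq_C] at hf
      have := h x
      rw [hf, eval_C] at this
      rw [hf, this, C_0]
      exact zero_mem _
  have htop : (homogeneousSubmodule (Fin (n+1)) k e).map (ev p) = ⊤ := by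
    apply Submodule.eq_top_of_finrank_eq
    rw [ev_eq_hilb p e I (hmem e), he, ← hcard]
    simp
  have hsep : ∀ i, ∃ f : MvPolynomial (Fin (n+1)) k, f.IsHomogeneous e ∧
      ∀ j, eval (p j) f = if j = i then 1 else 0 := by
    intro i
    have : (Pi.single i 1 : F → k) ∈ (homogeneousSubmodule (Fin (n+1)) k e).map (ev p) := by
      rw [htop]; trivial
    obtain ⟨f, hf, hfe⟩ := this
    refine ⟨f, hf, fun j => ?_⟩
    rw [← ev_apply, hfe, Pi.single_apply]
  choose ε hε hεp using hsep
  choose ξ τ hξ hξp hX hτl hτξ hτ using fun i => exists_coords a (p i) _ rfl (hp1 i)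
  exact ⟨F, inferInstance,
    { p := p, l := _, e := e, ε := ε, ξ := ξ, τ := τ, hom := hhom, hl := hlh a, hlp := hp1,
      inj := hpi, mem := hmem, hε := hε, hεp := hεp, hξ := hξ, hξp := hξp, hX := hX,
      hτl := hτl, hτξ := hτξ, hτ := hτ }, rfl, hcard⟩

end HilbPow

theorem hilbert_function_of_power_in_degrees_ge
    (k : Type*) [Field k] [IsAlgClosed k] (n : ℕ) (hn : 0 < n)
    (I : Ideal (MvPolynomial (Fin (n+1)) k))
    (hhom : I.IsHomogeneous (homogeneousSubmodule (Fin (n+1)) k))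
    (hrad : I.IsRadical) (r K : ℕ) (hr : 0 < r) (hK : 0 < K)
    (hH : ∃ D : ℕ, ∀ d ≥ D, hilb k n I d = r)
    (e : ℕ) (he : e = sInf {a : ℕ | hilb k n I a = r}) :
    ∀ d : ℕ, K * e + K ≤ d → hilb k n (I ^ K) d = r * (n + K - 1).choose n := by
  intro d hd
  have hne : {a : ℕ | hilb k n I a = r}.Nonempty := by
    obtain ⟨D, hD⟩ := hH
    exact ⟨D, hD D le_rfl⟩
  have her : hilb k n I e = r := by
    have := Nat.sInf_mem hne
    rw [← he] at this
    exact this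
  obtain ⟨F, _, D, hDe, hF⟩ := HilbPow.exists_ptData k n I hhom hrad r hr hH e her
  rw [← hF]
  exact D.hilb_pow K d hK (by rw [hDe]; exact hd)
end

section
/- Let X be a scheme locally of finite type over an algebraically closed field k. Let Z_1 and Z_2 be irreducible closed subsets of the underlying topological space of X, of (topological Krull) dimensions d_1 and d_2 respectively. Let P ∈ Z_1 ∩ Z_2 be a closed point, and let d = dim_k T_P X be the dimension over k of the Zariski tangent space of X at P (the dual over the residue field of m_P/m_P², where m_P is the maximal ideal of the local ring O_{X,P}). Then every irreducible component W of Z_1 ∩ Z_2 containing P satisfies dim W ≥ d_1 + d_2 − d. -/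
open AlgebraicGeometry

open Algebra TensorProduct

/-- Krull dimension is invariant under injective integral extensions. -/
theorem DCI.ringKrullDim_eq_of_integral {R S : Type*} [CommRing R] [CommRing S] [Algebra R S]
    [Algebra.IsIntegral R S] [Nontrivial R] (hinj : Function.Injective (algebraMap R S)) :
    ringKrullDim S = ringKrullDim R := by
  apply le_antisymm
  · refine Order.krullDim_le_of_strictMono
      (fun p : PrimeSpectrum S => PrimeSpectrum.comap (algebraMap R S) p) ?_
    intro p q hpq
    exact Ideal.IsIntegral.comap_lt_comap (I := p.asIdeal) (J := q.asIdeal) hpq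
  · refine iSup_le fun l => ?_
    obtain ⟨Q, -, hQ, hQ'⟩ := Ideal.exists_ideal_over_prime_of_isIntegral (S := S)
      (RelSeries.head l).asIdeal ⊥ (by
        rw [← RingHom.ker_eq_comap_bot, (RingHom.injective_iff_ker_eq_bot _).mp hinj]; exact bot_le)
    have : Q.LiesOver (RelSeries.head l).asIdeal := ⟨hQ'.symm⟩
    obtain ⟨L, hL, -⟩ := Ideal.exists_ltSeries_of_hasGoingUp l Q
    rw [← hL]
    exact le_iSup (fun L : LTSeries (PrimeSpectrum S) => (L.length : WithBot ℕ∞)) L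

/-- For a finitely generated domain, Krull dimension and transcendence degree agree. -/
theorem DCI.exists_dim {k D : Type} [Field k] [CommRing D] [IsDomain D] [Algebra k D]
    [Algebra.FiniteType k D] :
    ∃ s : ℕ, ringKrullDim D = s ∧ Algebra.trdeg k D = s ∧
      ∃ g : (MvPolynomial (Fin s) k) →ₐ[k] D, Function.Injective g ∧ g.Finite := by
  obtain ⟨s, g, hg, hf⟩ := exists_finite_inj_algHom_of_fg k D
  refine ⟨s, ?_, ?_, g, hg, hf⟩
  · let _ := g.toRingHom.toAlgebra
    have : Module.Finite (MvPolynomial (Fin s) k) D := hf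
    rw [DCI.ringKrullDim_eq_of_integral (R := MvPolynomial (Fin s) k) hg]
    simp [MvPolynomial.ringKrullDim_of_isNoetherianRing]
  · let _ := g.toRingHom.toAlgebra
    have : Module.Finite (MvPolynomial (Fin s) k) D := hf
    have : FaithfulSMul (MvPolynomial (Fin s) k) D := (faithfulSMul_iff_algebraMap_injective _ _).mpr hg
    have : IsScalarTower k (MvPolynomial (Fin s) k) D := IsScalarTower.of_algHom g
    rw [← trdeg_add_eq k (MvPolynomial (Fin s) k) (A := D)]
    simp [trdeg_eq_zero]


theorem DCI.exists_algHom_of_max {k A : Type} [Field k] [IsAlgClosed k] [CommRing A]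
    [Algebra k A] [Algebra.FiniteType k A] (m : Ideal A) [m.IsMaximal] :
    ∃ φ : A →ₐ[k] k, RingHom.ker φ = m := by
  let _ := Ideal.Quotient.field m
  have hfin : Module.Finite k (A ⧸ m) := finite_of_finite_type_of_isJacobsonRing k (A ⧸ m)
  have hb := IsAlgClosed.algebraMap_bijective_of_isIntegral (k := k) (K := A ⧸ m)
  let e : k ≃ₐ[k] (A ⧸ m) := AlgEquiv.ofBijective (Algebra.ofId k _) hb
  refine ⟨e.symm.toAlgHom.comp (Ideal.Quotient.mkₐ k m), ?_⟩
  ext x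
  simp [RingHom.mem_ker, Ideal.Quotient.eq_zero_iff_mem]

theorem DCI.exists_algHom {k A : Type} [Field k] [IsAlgClosed k] [CommRing A] [IsDomain A]
    [Algebra k A] [Algebra.FiniteType k A] (a : A) (ha : a ≠ 0) :
    ∃ φ : A →ₐ[k] k, φ a ≠ 0 := by
  have hJ : IsJacobsonRing A := isJacobsonRing_of_finiteType (A := k)
  have hjac : (⊥ : Ideal A).jacobson = ⊥ := (isJacobsonRing_iff.mp hJ) ⊥
      ((Ideal.isPrime_bot).isRadical)
  have : a ∉ (⊥ : Ideal A).jacobson := by rw [hjac]; simpa using ha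
  rw [Ideal.jacobson, Submodule.mem_sInf] at this
  push Not at this
  obtain ⟨m, ⟨-, hm⟩, ham⟩ := this
  obtain ⟨φ, hφ⟩ := DCI.exists_algHom_of_max (k := k) m
  exact ⟨φ, fun h => ham (hφ ▸ h)⟩

/-- Tensor product of domains over an algebraically closed field. -/
theorem DCI.isDomain_tensor {k A B : Type} [Field k] [IsAlgClosed k] [CommRing A] [IsDomain A]
    [Algebra k A] [Algebra.FiniteType k A] [CommRing B] [IsDomain B] [Algebra k B] :
    IsDomain (TensorProduct k A B) := by
  let b := Module.Basis.ofVectorSpace k B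
  let c := b.baseChange A
  have : Nontrivial (TensorProduct k A B) := inferInstance
  have key : ∀ x y : TensorProduct k A B, x ≠ 0 → y ≠ 0 → x * y ≠ 0 := by
    intro x y hx hy hxy
    obtain ⟨i, hi⟩ : ∃ i, c.repr x i ≠ 0 := by
      by_contra! h; exact hx (c.repr.map_eq_zero_iff.mp (Finsupp.ext h))
    obtain ⟨j, hj⟩ : ∃ j, c.repr y j ≠ 0 := by
      by_contra! h; exact hy (c.repr.map_eq_zero_iff.mp (Finsupp.ext h))
    obtain ⟨φ, hφ⟩ := DCI.exists_algHom (k := k) _ (mul_ne_zero hi hj)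
    rw [map_mul] at hφ
    let ψ : TensorProduct k A B →ₐ[k] B :=
      Algebra.TensorProduct.lift ((Algebra.ofId k B).comp φ) (AlgHom.id k B)
        (fun _ _ => Commute.all _ _)
    have hψ : ∀ (z : TensorProduct k A B) (i), b.repr (ψ z) i = φ (c.repr z i) := by
      intro z i
      induction z using TensorProduct.induction_on with
      | zero => simp
      | add u v hu hv => simp [hu, hv]
      | tmul u v =>
        have : ψ (u ⊗ₜ[k] v) = φ u • v := by
          simp [ψ, Algebra.ofId_apply, Algebra.smul_def]
        rw [this]
        simp [c, mul_comm]
    have h0 : ψ x * ψ y = 0 := by rw [← map_mul, hxy, map_zero]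
    rcases mul_eq_zero.mp h0 with h | h
    · exact left_ne_zero_of_mul hφ (by rw [← hψ, h]; simp)
    · exact right_ne_zero_of_mul hφ (by rw [← hψ, h]; simp)
  have : NoZeroDivisors (TensorProduct k A B) := ⟨fun {x y} h => by
    by_contra! hh; exact key x y hh.1 hh.2 h⟩
  exact IsDomain.mk

/-- Transcendence degree of the tensor product. -/
theorem DCI.trdeg_tensor {k A B : Type} [Field k] [CommRing A] [IsDomain A]
    [Algebra k A]  [CommRing B] [IsDomain B] [Algebra k B] [IsDomain (TensorProduct k A B)]
    (s : ℕ) (g : (MvPolynomial (Fin s) k) →ₐ[k] B) (hg : Function.Injective g) :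
    Algebra.trdeg k A + s ≤ Algebra.trdeg k (TensorProduct k A B) := by
  have hinj : Function.Injective (algebraMap A (TensorProduct k A B)) :=
    Algebra.TensorProduct.includeLeft_injective (S := k) (FaithfulSMul.algebraMap_injective k B)
  have : FaithfulSMul A (TensorProduct k A B) := (faithfulSMul_iff_algebraMap_injective _ _).mpr hinj
  rw [← trdeg_add_eq k A (A := TensorProduct k A B)]
  gcongr
  let G : MvPolynomial (Fin s) A →ₐ[A] TensorProduct k A B :=
    (Algebra.TensorProduct.map (AlgHom.id A A) g).comp
      (MvPolynomial.algebraTensorAlgEquiv k A (σ := Fin s)).symm.toAlgHom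
  have hG : Function.Injective G := by
    have h1 : Function.Injective (Algebra.TensorProduct.map (AlgHom.id A A) g) :=
      Module.Flat.lTensor_preserves_injective_linearMap (M := A) g.toLinearMap hg
    exact h1.comp (MvPolynomial.algebraTensorAlgEquiv k A (σ := Fin s)).symm.injective
  have := trdeg_le_of_injective G hG
  simpa using this

theorem DCI.isAlgebraic_of_qf {R C : Type} [CommRing R] [CommRing C] [IsDomain R] [IsDomain C]
    [Algebra R C] (hinj : Function.Injective (algebraMap R C))
    (hqf0 : Algebra.QuasiFiniteAt R (⊥ : Ideal C)) : Algebra.IsAlgebraic R C := by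
  let K := FractionRing C
  have hqK : Algebra.QuasiFinite R K := by
    have : IsLocalization (nonZeroDivisors C) (Localization.AtPrime (⊥ : Ideal C)) := by
      have : (⊥ : Ideal C).primeCompl = nonZeroDivisors C := by
        ext; simp [Ideal.primeCompl]
      rw [← this]; infer_instance
    let e : Localization.AtPrime (⊥ : Ideal C) ≃ₐ[C] K := IsLocalization.algEquiv (nonZeroDivisors C) _ _
    have hqf1 : Algebra.QuasiFinite R (Localization.AtPrime (⊥ : Ideal C)) := hqf0
    exact Algebra.QuasiFinite.of_surjective_algHom (S := Localization.AtPrime (⊥ : Ideal C))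
      (e.restrictScalars R).toAlgHom e.surjective
  have hinjK : Function.Injective (algebraMap R K) := by
    rw [IsScalarTower.algebraMap_eq R C K]
    exact (IsFractionRing.injective C K).comp hinj
  have halg : Algebra.IsAlgebraic R K := by
    have : FaithfulSMul R K := (faithfulSMul_iff_algebraMap_injective _ _).mpr hinjK
    let L := FractionRing R
    let _ : Algebra L K := FractionRing.liftAlgebra R K
    have : IsScalarTower R L K := FractionRing.isScalarTower_liftAlgebra R K
    have : Algebra.QuasiFinite L K := Algebra.QuasiFinite.of_restrictScalars R L K
    have : Module.Finite L K := Module.Finite.of_quasiFinite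
    exact (IsFractionRing.comap_isAlgebraic_iff (A := R) (K := L) (C := K)).mpr (Algebra.IsAlgebraic.of_finite L K)
  constructor
  intro x
  have := halg.1 (algebraMap C K x)
  rwa [isAlgebraic_algebraMap_iff (IsFractionRing.injective C K)] at this

/-- The dimension inequality `dim C ≤ ht Q + dim C/Q`, via the main theorem of Zariski. -/
theorem DCI.trdeg_le_height_add {k C : Type} [Field k] [CommRing C] [IsDomain C]
    [Algebra k C] [Algebra.FiniteType k C] (Q : Ideal C) [hQp : Q.IsPrime] (h r : ℕ)
    (hh : Q.height ≤ h) (hr : ringKrullDim (C ⧸ Q) = r) :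
    Algebra.trdeg k C ≤ ((h + r : ℕ) : Cardinal) := by
  classical
  have hN : IsNoetherianRing C := Algebra.FiniteType.isNoetherianRing k C
  obtain ⟨F, hFmin, hFc⟩ := Ideal.exists_finset_card_eq_height_of_isNoetherianRing Q
  obtain ⟨r', hr', -, g0, hg0i, hg0f⟩ := DCI.exists_dim (k := k) (D := C ⧸ Q)
  obtain rfl : r' = r := by
    have := hr'.symm.trans hr
    exact_mod_cast this
  choose s hs using fun i : Fin r' => Ideal.Quotient.mk_surjective (I := Q) (g0 (MvPolynomial.X i))
  let T : Finset C := F ∪ Finset.univ.image s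
  let R := Algebra.adjoin k (T : Set C)
  have hFR : ∀ x ∈ F, x ∈ R := fun x hx => Algebra.subset_adjoin (by simp [T, hx])
  have hsR : ∀ i, s i ∈ R := fun i => Algebra.subset_adjoin (by simp [T])
  have hft : Algebra.FiniteType R C := Algebra.FiniteType.of_restrictScalars_finiteType k R C
  -- integrality
  have hintQ : (algebraMap R (C ⧸ Q)).IsIntegral := by
    let hmap : MvPolynomial (Fin r') k →ₐ[k] R := MvPolynomial.aeval (fun i => ⟨s i, hsR i⟩)
    have hc : (IsScalarTower.toAlgHom k R (C ⧸ Q)).comp hmap = g0 := by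
      apply MvPolynomial.algHom_ext
      intro i
      simp only [AlgHom.comp_apply, hmap, MvPolynomial.aeval_X, IsScalarTower.toAlgHom_apply]
      exact hs i
    have hc' : (algebraMap R (C ⧸ Q)).comp hmap.toRingHom = g0.toRingHom :=
      congrArg AlgHom.toRingHom hc
    refine RingHom.IsIntegral.tower_top hmap.toRingHom _ ?_
    rw [hc']
    exact RingHom.Finite.to_isIntegral hg0f
  -- other minimal primes
  obtain ⟨g, hgQ, hg⟩ : ∃ g ∉ Q, ∀ q' : Ideal C, q'.IsPrime → Ideal.span (F : Set C) ≤ q' →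
      g ∉ q' → Q ≤ q' := by
    have hfin := Ideal.finite_minimalPrimes_of_isNoetherianRing C (Ideal.span (F : Set C))
    let O := hfin.toFinset.erase Q
    have hO : ¬ O.inf _root_.id ≤ Q := by
      rw [Ideal.IsPrime.inf_le' hQp]
      rintro ⟨P, hP, hPQ⟩
      simp only [O, Finset.mem_erase, Set.Finite.mem_toFinset, _root_.id] at hP hPQ
      exact hP.1 (le_antisymm hPQ (hFmin.2 hP.2.1 hPQ))
    obtain ⟨g, hg, hgQ⟩ := SetLike.not_le_iff_exists.mp hO
    refine ⟨g, hgQ, fun q' hq' hle hgq => ?_⟩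
    obtain ⟨P, hP, hPq⟩ := Ideal.exists_minimalPrimes_le hle
    by_cases hPQ : P = Q
    · exact hPQ ▸ hPq
    · refine absurd (hPq ?_) hgq
      have : O.inf _root_.id ≤ P := Finset.inf_le (f := _root_.id) (by simp [O, hPQ, hP])
      exact this hg
  have hqf : Algebra.QuasiFiniteAt R Q := by
    refine Algebra.QuasiFiniteAt.of_isOpen_singleton_fiber (R := R) (⟨Q, hQp⟩ : PrimeSpectrum C) ?_
    refine ⟨PrimeSpectrum.basicOpen g, (PrimeSpectrum.basicOpen g).2, ?_⟩
    ext ⟨q', hq'⟩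
    simp only [Set.mem_preimage, Set.mem_singleton_iff] at hq' ⊢
    constructor
    · intro hgq
      have hgq' : g ∉ q'.asIdeal := hgq
      have hc : ∀ x : R, (x : C) ∈ q'.asIdeal ↔ (x : C) ∈ Q := fun x => by
        have := congrArg (fun p => x ∈ PrimeSpectrum.asIdeal p) hq'
        exact iff_of_eq this
      have hle : Q ≤ q'.asIdeal := by
        refine hg _ q'.2 (Ideal.span_le.mpr fun x hx => ?_) hgq'
        exact (hc ⟨x, hFR x hx⟩).mpr (hFmin.1.2 (Ideal.subset_span hx))
      refine Subtype.ext (PrimeSpectrum.ext ?_)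
      by_contra hne
      obtain ⟨x, hx, hxQ⟩ := SetLike.exists_of_lt (lt_of_le_of_ne hle (Ne.symm hne))
      obtain ⟨p, hpm, hp⟩ := hintQ (Ideal.Quotient.mk Q x)
      have := Ideal.comap_lt_comap_of_root_mem_sdiff (f := algebraMap R C) hle ⟨hx, hxQ⟩
        (p := p) ?_ ?_
      · obtain ⟨y, hy, hyQ⟩ := SetLike.exists_of_lt this
        exact hyQ ((hc y).mp hy)
      · have : (Q.comap (algebraMap R C)).IsPrime := inferInstance
        exact (hpm.map _).ne_zero
      · rw [← Ideal.Quotient.eq_zero_iff_mem, Polynomial.hom_eval₂]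
        exact hp
    · intro he
      show g ∉ q'.asIdeal
      have he' : q' = ⟨Q, hQp⟩ := congrArg Subtype.val he
      rw [he']; exact hgQ
  have hqf0 : Algebra.QuasiFiniteAt R (⊥ : Ideal C) := .of_le (Q := Q) bot_le
  have halgC : Algebra.IsAlgebraic R C := DCI.isAlgebraic_of_qf Subtype.val_injective hqf0
  have h1 : Algebra.trdeg k C ≤ Cardinal.mk (T : Set C) :=
    Algebra.IsAlgebraic.trdeg_le_cardinalMk (R := k) (A := C) (T : Set C)
  refine h1.trans ?_
  simp only [Finset.coe_sort_coe, Cardinal.mk_fintype, Fintype.card_coe, Nat.cast_le]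
  have hFh : F.card ≤ h := by
    have : (F.card : ℕ∞) ≤ h := hFc ▸ hh
    exact_mod_cast this
  refine (Finset.card_union_le _ _).trans (add_le_add hFh ?_)
  exact (Finset.card_image_le).trans (by simp)

theorem DCI.ft_tensor (k A B : Type) [Field k] [CommRing A] [Algebra k A] [CommRing B] [Algebra k B]
    [hA : Algebra.FiniteType k A] [Algebra.FiniteType k B] : Algebra.FiniteType k (A ⊗[k] B) :=
  Algebra.FiniteType.trans hA (Algebra.FiniteType.baseChange A)

/-- Generators of `m` modulo `m ^ 2`, in terms of the cotangent space of the local ring. -/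
theorem DCI.exists_gens {A S : Type} [CommRing A] [IsNoetherianRing A] (m : Ideal A) [m.IsMaximal]
    [CommRing S] [IsLocalRing S] [Algebra A S] [IsLocalization.AtPrime S m] (d : ℕ)
    (hd : Module.finrank (IsLocalRing.ResidueField S) (IsLocalRing.CotangentSpace S) = d) :
    ∃ a : Finset A, a.card ≤ d ∧ (a : Set A) ⊆ m ∧ m ≤ Ideal.span (a : Set A) ⊔ m * m := by
  classical
  have hS : IsNoetherianRing S := IsLocalization.isNoetherianRing m.primeCompl S inferInstance
  obtain ⟨s, hsc, hs⟩ := Submodule.FG.exists_span_finset_card_eq_spanFinrank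
    (IsLocalRing.maximalIdeal S).fg_of_isNoetherianRing
  rw [IsLocalRing.spanFinrank_maximalIdeal_eq_finrank_cotangentSpace, hd] at hsc
  choose n hn using fun x : S => IsLocalization.surj m.primeCompl x
  have hmem : ∀ x ∈ s, (n x).1 ∈ m := by
    intro x hx
    have : x ∈ IsLocalRing.maximalIdeal S := hs ▸ Submodule.subset_span hx
    rw [← IsLocalization.AtPrime.to_map_mem_maximal_iff S m, ← hn]
    exact Ideal.mul_mem_right _ _ this
  refine ⟨s.image (fun x => (n x).1), Finset.card_image_le.trans hsc.le, ?_, ?_⟩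
  · intro y hy
    simp only [Finset.coe_image, Set.mem_image] at hy
    obtain ⟨x, hx, rfl⟩ := hy
    exact hmem x hx
  · intro x hx
    set I := Ideal.span ((s.image (fun x => (n x).1) : Finset A) : Set A)
    have h1 : IsLocalRing.maximalIdeal S ≤ I.map (algebraMap A S) := by
      rw [← hs]
      refine Ideal.span_le.mpr fun y hy => ?_
      have h2 : algebraMap A S (n y).1 ∈ I.map (algebraMap A S) :=
        Ideal.mem_map_of_mem _ (Ideal.subset_span (by
          simp only [Finset.coe_image]; exact ⟨y, hy, rfl⟩))
      rw [← hn] at h2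
      exact (Ideal.mul_unit_mem_iff_mem _ (IsLocalization.map_units S (n y).2)).mp h2
    have h3 := h1 ((IsLocalization.AtPrime.to_map_mem_maximal_iff S m x).mpr hx)
    rw [IsLocalization.algebraMap_mem_map_algebraMap_iff m.primeCompl] at h3
    obtain ⟨t, ht, htx⟩ := h3
    obtain ⟨u, hu⟩ := Ideal.IsMaximal.exists_inv (I := m) inferInstance ht
    obtain ⟨v, hv, huv⟩ := hu
    have : x = u * (t * x) + v * x := by linear_combination (-x) * huv
    rw [this]
    exact Submodule.add_mem_sup (Ideal.mul_mem_left _ _ htx) (Ideal.mul_mem_mul hv hx)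

open KaehlerDifferential in
theorem DCI.diag {k A : Type} [Field k] [IsAlgClosed k] [CommRing A] [Algebra k A]
    [Algebra.FiniteType k A] (m : Ideal A) [m.IsMaximal] (a : Finset A) (ha : (a : Set A) ⊆ m)
    (hm : m ≤ Ideal.span (a : Set A) ⊔ m * m) :
    ∃ t : A ⊗[k] A, Algebra.TensorProduct.lmul' k (S := A) t - 1 ∈ m ∧
      ∀ w ∈ KaehlerDifferential.ideal k A, t * w ∈
        Ideal.span ((fun x : A => (1 : A) ⊗ₜ[k] x - x ⊗ₜ[k] (1 : A)) '' (a : Set A)) := by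
  have hFT := DCI.ft_tensor k A A
  have hN : IsNoetherianRing (A ⊗[k] A) := Algebra.FiniteType.isNoetherianRing k _
  set δ : A → A ⊗[k] A := (fun x : A => (1 : A) ⊗ₜ[k] x - x ⊗ₜ[k] (1 : A)) with hδ
  set I := KaehlerDifferential.ideal k A
  set K := Ideal.span (δ '' (a : Set A))
  let M : Ideal (A ⊗[k] A) := m.comap (Algebra.TensorProduct.lmul' k (S := A))
  have hδI : ∀ x, δ x ∈ I := fun x => KaehlerDifferential.one_smul_sub_smul_one_mem_ideal k x
  have hleib : ∀ x y, δ (x * y) = ((1 : A) ⊗ₜ[k] x) * δ y + (y ⊗ₜ[k] (1 : A)) * δ x := by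
    intro x y
    simp only [hδ, mul_sub, Algebra.TensorProduct.tmul_mul_tmul, one_mul, mul_one]
    rw [mul_comm y x]; ring
  have hadd : ∀ x y, δ (x + y) = δ x + δ y := by
    intro x y; simp only [hδ, TensorProduct.tmul_add, TensorProduct.add_tmul]; ring
  have hM1 : ∀ x ∈ m, x ⊗ₜ[k] (1 : A) ∈ M := fun x hx => by
    simpa [M, Ideal.mem_comap] using hx
  have hM2 : ∀ x ∈ m, (1 : A) ⊗ₜ[k] x ∈ M := fun x hx => by
    simpa [M, Ideal.mem_comap] using hx
  have hspan : ∀ x ∈ Ideal.span (a : Set A), δ x ∈ K ⊔ M * I := by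
    intro x hx
    induction hx using Submodule.span_induction with
    | mem x h => exact Ideal.mem_sup_left (Ideal.subset_span ⟨x, h, rfl⟩)
    | zero => simp [hδ]
    | add x y _ _ hx hy => rw [hadd]; exact add_mem hx hy
    | smul b x h hx =>
      rw [smul_eq_mul, hleib]
      refine add_mem (Ideal.mul_mem_left _ _ hx) (Ideal.mem_sup_right
        (Ideal.mul_mem_mul (hM1 _ (Ideal.span_le.mpr ha h)) (hδI _)))
  have hmm : ∀ x ∈ m * m, δ x ∈ K ⊔ M * I := by
    intro x hx
    induction hx using Submodule.mul_induction_on' with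
    | mem_mul_mem x hx y hy =>
      rw [hleib]
      exact Ideal.mem_sup_right (add_mem (Ideal.mul_mem_mul (hM2 _ hx) (hδI _))
        (Ideal.mul_mem_mul (hM1 _ hy) (hδI _)))
    | add x _ y _ hx hy => rw [hadd]; exact add_mem hx hy
  have hall : ∀ x, δ x ∈ K ⊔ M * I := by
    intro x
    obtain ⟨φ, hφ⟩ := DCI.exists_algHom_of_max (k := k) m
    have hy : x - algebraMap k A (φ x) ∈ m := by
      rw [← hφ, RingHom.mem_ker]; simp
    obtain ⟨y, hy1, z, hz, hyz⟩ := Submodule.mem_sup.mp (hm hy)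
    have hx : x = algebraMap k A (φ x) + (y + z) := by rw [hyz]; ring
    have hc : δ (algebraMap k A (φ x)) = 0 := by
      simp [hδ, Algebra.algebraMap_eq_smul_one, TensorProduct.smul_tmul]
    rw [hx, hadd, hadd, hc, zero_add]
    exact add_mem (hspan _ hy1) (hmm _ hz)
  have hIle : I ≤ K ⊔ M • I := by
    have : I = Ideal.span (Set.range δ) := (KaehlerDifferential.span_range_eq_ideal k A).symm
    conv_lhs => rw [this]
    refine Ideal.span_le.mpr ?_
    rintro _ ⟨x, rfl⟩
    exact hall x
  obtain ⟨t, ht, htI⟩ := Submodule.exists_sub_one_mem_and_smul_le_of_fg_of_le_sup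
    (I := M) (N := K) (N' := I) (P := I) I.fg_of_isNoetherianRing le_rfl hIle
  refine ⟨t, by simpa [M, Ideal.mem_comap] using ht, fun w hw => ?_⟩
  exact htI (Submodule.smul_mem_pointwise_smul w t I hw)

theorem DCI.algebra_main {k A S : Type} [Field k] [IsAlgClosed k] [CommRing A] [Algebra k A]
    [Algebra.FiniteType k A] (m : Ideal A) [hmm : m.IsMaximal]
    [CommRing S] [IsLocalRing S] [Algebra A S] [IsLocalization.AtPrime S m] (d : ℕ)
    (hd : Module.finrank (IsLocalRing.ResidueField S) (IsLocalRing.CotangentSpace S) = d)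
    (p₁ p₂ q : Ideal A) [p₁.IsPrime] [p₂.IsPrime] (hq : q ∈ (p₁ ⊔ p₂).minimalPrimes)
    (hqm : q ≤ m) :
    ringKrullDim (A ⧸ p₁) + ringKrullDim (A ⧸ p₂) ≤ ringKrullDim (A ⧸ q) + d := by
  classical
  have hN : IsNoetherianRing A := Algebra.FiniteType.isNoetherianRing k _
  have hqp : q.IsPrime := hq.1.1
  obtain ⟨a, hac, ham, hm⟩ := DCI.exists_gens (S := S) m d hd
  obtain ⟨t, ht, htI⟩ := DCI.diag (k := k) m a ham hm
  obtain ⟨s₁, hs₁, ht₁, -⟩ := DCI.exists_dim (k := k) (D := A ⧸ p₁)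
  obtain ⟨s₂, hs₂, ht₂, g₂, hg₂, -⟩ := DCI.exists_dim (k := k) (D := A ⧸ p₂)
  obtain ⟨r, hr, -⟩ := DCI.exists_dim (k := k) (D := A ⧸ q)
  have hle1 : p₁ ≤ q := le_sup_left.trans hq.1.2
  have hle2 : p₂ ≤ q := le_sup_right.trans hq.1.2
  let C := (A ⧸ p₁) ⊗[k] (A ⧸ p₂)
  have hdom : IsDomain C := DCI.isDomain_tensor
  have hFT : Algebra.FiniteType k C := DCI.ft_tensor k _ _
  have hNC : IsNoetherianRing C := Algebra.FiniteType.isNoetherianRing k _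
  let π : A ⊗[k] A →ₐ[k] C :=
    Algebra.TensorProduct.map (Ideal.Quotient.mkₐ k p₁) (Ideal.Quotient.mkₐ k p₂)
  have hπt : ∀ x y, π (x ⊗ₜ y) = (Ideal.Quotient.mk p₁ x) ⊗ₜ[k] (Ideal.Quotient.mk p₂ y) :=
    fun _ _ => rfl
  have hπ : Function.Surjective π := TensorProduct.map_surjective
    Ideal.Quotient.mk_surjective Ideal.Quotient.mk_surjective
  let ρ : C →ₐ[k] A ⧸ q := Algebra.TensorProduct.lift
    (Ideal.Quotient.factorₐ k hle1) (Ideal.Quotient.factorₐ k hle2) (fun _ _ => Commute.all _ _)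
  let μ := Algebra.TensorProduct.lmul' k (S := A)
  have hρπ : ∀ w, ρ (π w) = Ideal.Quotient.mk q (μ w) := by
    have : ρ.comp π = (Ideal.Quotient.mkₐ k q).comp μ := by
      ext x
      · show ρ (π (x ⊗ₜ 1)) = Ideal.Quotient.mk q (μ (x ⊗ₜ 1))
        rw [hπt]
        show Algebra.TensorProduct.lift (Ideal.Quotient.factorₐ k hle1)
          (Ideal.Quotient.factorₐ k hle2) (fun _ _ => Commute.all _ _) _ = _
        rw [Algebra.TensorProduct.lift_tmul]
        simp [μ]
      · show ρ (π (1 ⊗ₜ x)) = Ideal.Quotient.mk q (μ (1 ⊗ₜ x))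
        rw [hπt]
        show Algebra.TensorProduct.lift (Ideal.Quotient.factorₐ k hle1)
          (Ideal.Quotient.factorₐ k hle2) (fun _ _ => Commute.all _ _) _ = _
        rw [Algebra.TensorProduct.lift_tmul]
        simp [μ]
    intro w
    exact DFunLike.congr_fun this w
  have hρ : Function.Surjective ρ := by
    intro y
    obtain ⟨x, rfl⟩ := Ideal.Quotient.mk_surjective y
    exact ⟨π (x ⊗ₜ 1), by rw [hρπ]; simp [μ]⟩
  let Q : Ideal C := RingHom.ker ρ
  have hQp : Q.IsPrime := RingHom.ker_isPrime _
  have hdimQ : ringKrullDim (C ⧸ Q) = r := by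
    rw [← hr]
    exact ringKrullDim_eq_of_ringEquiv (RingHom.quotientKerEquivOfSurjective (f := ρ.toRingHom) hρ)
  set δ : A → A ⊗[k] A := (fun x : A => (1 : A) ⊗ₜ[k] x - x ⊗ₜ[k] (1 : A)) with hδ
  let F : Finset C := a.image (fun x => π (δ x))
  have hFmap : (Ideal.span (δ '' (a : Set A))).map π = Ideal.span (F : Set C) := by
    rw [Ideal.map_span, ← Set.image_comp]
    simp only [F, Finset.coe_image]; rfl
  have hmin : Q ∈ (Ideal.span (F : Set C)).minimalPrimes := by
    refine ⟨⟨hQp, ?_⟩, ?_⟩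
    · refine Ideal.span_le.mpr ?_
      intro y hy
      simp only [F, Finset.coe_image] at hy
      obtain ⟨x, hx, rfl⟩ := hy
      show ρ (π (δ x)) = 0
      rw [hρπ]; simp [μ, hδ]
    · rintro q' ⟨hq'p, hFq'⟩ hq'Q
      have htQ : π t ∉ Q := by
        intro h
        have h' : ρ (π t) = 0 := h
        rw [hρπ, Ideal.Quotient.eq_zero_iff_mem] at h'
        refine hmm.ne_top ((Ideal.eq_top_iff_one m).mpr ?_)
        have := sub_mem (hqm h') ht
        simpa [μ] using this
      have hI : ∀ w ∈ KaehlerDifferential.ideal k A, π w ∈ q' := by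
        intro w hw
        have h1 : π (t * w) ∈ q' := hFq' (hFmap ▸ Ideal.mem_map_of_mem π (htI w hw))
        rw [map_mul] at h1
        exact (hq'p.mem_or_mem h1).resolve_left fun h => htQ (hq'Q h)
      let ι : A →ₐ[k] C := π.comp Algebra.TensorProduct.includeLeft
      let q'' := q'.comap ι
      have hq''p : q''.IsPrime := Ideal.comap_isPrime _ _
      have hle'' : p₁ ⊔ p₂ ≤ q'' := by
        refine sup_le ?_ ?_
        · intro x hx
          show π (x ⊗ₜ 1) ∈ q'
          have : π (x ⊗ₜ 1) = 0 := by
            rw [hπt, Ideal.Quotient.eq_zero_iff_mem.mpr hx, TensorProduct.zero_tmul]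
          rw [this]; exact zero_mem _
        · intro x hx
          show π (x ⊗ₜ 1) ∈ q'
          have h0 : π (1 ⊗ₜ x) = 0 := by
            rw [hπt, Ideal.Quotient.eq_zero_iff_mem.mpr hx, TensorProduct.tmul_zero]
          have h1 := hI _ (KaehlerDifferential.one_smul_sub_smul_one_mem_ideal k x)
          rw [map_sub, h0, zero_sub] at h1
          exact neg_mem_iff.mp h1
      have hle''q : q'' ≤ q := by
        intro x hx
        have : ρ (π (x ⊗ₜ 1)) = 0 := hq'Q hx
        rw [hρπ] at this
        simpa [μ, Ideal.Quotient.eq_zero_iff_mem] using this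
      have hqq'' : q ≤ q'' := hq.2 ⟨hq''p, hle''⟩ hle''q
      intro z hz
      obtain ⟨w, rfl⟩ := hπ z
      have h1 : π (w - (μ w) ⊗ₜ 1) ∈ q' := hI _ (by
        show μ _ = 0
        simp [μ])
      have h2 : ρ (π w) = 0 := hz
      rw [hρπ, Ideal.Quotient.eq_zero_iff_mem] at h2
      have h3 : π ((μ w) ⊗ₜ 1) ∈ q' := hqq'' h2
      have := add_mem h1 h3
      rwa [← map_add, sub_add_cancel] at this
  have hht : Q.height ≤ d :=
    (Ideal.height_le_card_of_mem_minimalPrimes_span_finset hmin).trans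
      (by exact_mod_cast Finset.card_image_le.trans hac)
  have hup := DCI.trdeg_le_height_add (k := k) Q d r hht hdimQ
  have hlow := (DCI.trdeg_tensor (k := k) (A := A ⧸ p₁) s₂ g₂ hg₂).trans hup
  rw [ht₁] at hlow
  have hlow' : s₁ + s₂ ≤ d + r := by exact_mod_cast hlow
  rw [hs₁, hs₂, hr]
  have : s₁ + s₂ ≤ r + d := by omega
  exact_mod_cast this

/-- Dimension of `A ⧸ p` in terms of the residue field of the local ring at `p`. -/
theorem DCI.dim_local {k A S : Type} [Field k] [CommRing A] [Algebra k A]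
    [Algebra.FiniteType k A] (p : Ideal A) [p.IsPrime]
    [CommRing S] [IsLocalRing S] [Algebra A S] [IsLocalization.AtPrime S p] [Algebra k S]
    [IsScalarTower k A S] :
    ∃ n : ℕ, ringKrullDim (A ⧸ p) = n ∧ Algebra.trdeg k (IsLocalRing.ResidueField S) = n := by
  obtain ⟨n, hn, hn', -⟩ := DCI.exists_dim (k := k) (D := A ⧸ p)
  refine ⟨n, hn, ?_⟩
  let κ := IsLocalRing.ResidueField S
  have hmem : ∀ x : A, algebraMap A κ x = 0 ↔ x ∈ p := by
    intro x
    rw [IsScalarTower.algebraMap_apply A S κ, IsLocalRing.ResidueField.algebraMap_eq,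
      IsLocalRing.residue_eq_zero_iff, IsLocalization.AtPrime.to_map_mem_maximal_iff S p]
  let ψ : A ⧸ p →+* κ := Ideal.Quotient.lift p (algebraMap A κ) (fun x hx => (hmem x).mpr hx)
  let _ : Algebra (A ⧸ p) κ := ψ.toAlgebra
  have : IsScalarTower k (A ⧸ p) κ := by
    refine IsScalarTower.of_algebraMap_eq fun c => ?_
    have : algebraMap k κ c = algebraMap A κ (algebraMap k A c) := by
      rw [IsScalarTower.algebraMap_apply k S κ, IsScalarTower.algebraMap_apply k A S,
        IsScalarTower.algebraMap_apply A S κ]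
    rw [this]; rfl
  have hinj : Function.Injective ψ := by
    rw [injective_iff_map_eq_zero]
    intro y hy
    obtain ⟨x, rfl⟩ := Ideal.Quotient.mk_surjective y
    exact Ideal.Quotient.eq_zero_iff_mem.mpr ((hmem x).mp hy)
  have : FaithfulSMul (A ⧸ p) κ := (faithfulSMul_iff_algebraMap_injective _ _).mpr hinj
  have : Algebra.IsAlgebraic (A ⧸ p) κ := by
    constructor
    intro z
    obtain ⟨y, rfl⟩ := IsLocalRing.residue_surjective z
    obtain ⟨⟨a, s⟩, has⟩ := IsLocalization.surj p.primeCompl y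
    refine ⟨Polynomial.C (Ideal.Quotient.mk p s) * Polynomial.X - Polynomial.C (Ideal.Quotient.mk p a),
      ?_, ?_⟩
    · intro h0
      have := congrArg (fun P => Polynomial.coeff P 1) h0
      simp only [Polynomial.coeff_sub, Polynomial.coeff_C_mul, Polynomial.coeff_X_one, mul_one,
        Polynomial.coeff_C_succ, sub_zero, Polynomial.coeff_zero] at this
      exact s.2 (Ideal.Quotient.eq_zero_iff_mem.mp this)
    · have h1 : ψ (Ideal.Quotient.mk p s) * IsLocalRing.residue S y = ψ (Ideal.Quotient.mk p a) := by
        show algebraMap A κ s * IsLocalRing.residue S y = algebraMap A κ a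
        rw [IsScalarTower.algebraMap_apply A S κ, IsScalarTower.algebraMap_apply A S κ,
          IsLocalRing.ResidueField.algebraMap_eq, ← map_mul, mul_comm, has]
      simp only [map_sub, map_mul, Polynomial.aeval_C, Polynomial.aeval_X]
      exact sub_eq_zero.mpr h1
  rw [← trdeg_add_eq k (A ⧸ p) (A := κ), hn', trdeg_eq_zero, add_zero]

open TopologicalSpace in
theorem DCI.dim_le_of_cover {Z : Type} [TopologicalSpace Z] (n : WithBot ℕ∞)
    (h : ∀ x : Z, ∃ (Y : Type) (_ : TopologicalSpace Y) (g : Y → Z), Topology.IsOpenEmbedding g ∧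
      x ∈ Set.range g ∧ topologicalKrullDim Y ≤ n) : topologicalKrullDim Z ≤ n := by
  rw [topologicalKrullDim, Order.krullDim_eq_iSup_coheight]
  refine iSup_le fun T => ?_
  obtain ⟨x, hx⟩ := T.isIrreducible.nonempty
  obtain ⟨Y, _, g, hg, ⟨y, rfl⟩, hY⟩ := h x
  let T' : {V : IrreducibleCloseds Z | (g ⁻¹' V).Nonempty} := ⟨T, ⟨y, hx⟩⟩
  let V := (IrreducibleCloseds.orderIsoOfIsOpenEmbedding g hg).symm T'
  have hV : IrreducibleCloseds.map g hg.continuous V = T :=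
    congrArg Subtype.val ((IrreducibleCloseds.orderIsoOfIsOpenEmbedding g hg).apply_symm_apply T')
  rw [← hV, hg.coheight_map]
  exact (Order.coheight_le_krullDim V).trans hY



/-- The structure map to the stalk. -/
noncomputable def DCI.toStalk {k : Type} [Field k] {X : Scheme.{0}}
    (f : X ⟶ Spec (CommRingCat.of k)) (x : X) : k →+* X.presheaf.stalk x :=
  (X.presheaf.germ ⊤ x trivial).hom.comp (f.appTop.hom.comp
    (Scheme.ΓSpecIso (CommRingCat.of k)).inv.hom)

/-- The structure map to sections. -/
noncomputable def DCI.toSec {k : Type} [Field k] {X : Scheme.{0}}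
    (f : X ⟶ Spec (CommRingCat.of k)) (U : X.Opens) : k →+* Γ(X, U) :=
  (f.appLE ⊤ U le_top).hom.comp (Scheme.ΓSpecIso (CommRingCat.of k)).inv.hom

theorem DCI.germ_toSec {k : Type} [Field k] {X : Scheme.{0}}
    (f : X ⟶ Spec (CommRingCat.of k)) (U : X.Opens) (x : X) (hx : x ∈ U) :
    (X.presheaf.germ U x hx).hom.comp (DCI.toSec f U) = DCI.toStalk f x := by
  have h : CategoryTheory.CategoryStruct.comp (f.appLE ⊤ U le_top) (X.presheaf.germ U x hx) =
      CategoryTheory.CategoryStruct.comp f.appTop (X.presheaf.germ ⊤ x trivial) := by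
    unfold Scheme.Hom.appLE
    rw [CategoryTheory.Category.assoc]
    congr 1
    exact X.presheaf.germ_res (CategoryTheory.homOfLE le_top) x hx
  have h' := congrArg CommRingCat.Hom.hom h
  rw [CommRingCat.hom_comp, CommRingCat.hom_comp] at h'
  rw [DCI.toSec, DCI.toStalk, ← RingHom.comp_assoc, h', RingHom.comp_assoc]

theorem DCI.toSec_ft {k : Type} [Field k] {X : Scheme.{0}}
    (f : X ⟶ Spec (CommRingCat.of k)) [LocallyOfFiniteType f] (U : X.Opens) (hU : IsAffineOpen U) :
    (DCI.toSec f U).FiniteType := by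
  have h1 := HasRingHomProperty.appLE @LocallyOfFiniteType f inferInstance
    ⟨⊤, isAffineOpen_top _⟩ ⟨U, hU⟩ le_top
  refine RingHom.FiniteType.comp h1 (RingHom.FiniteType.of_surjective _ ?_)
  exact (Scheme.ΓSpecIso (CommRingCat.of k)).symm.commRingCatIsoToRingEquiv.surjective

theorem DCI.dim_affine {k : Type} [Field k] {X : Scheme.{0}}
    (f : X ⟶ Spec (CommRingCat.of k)) [LocallyOfFiniteType f] (x : X) :
    ∃ n : ℕ, ∀ (U : X.Opens) (hU : IsAffineOpen U) (hx : x ∈ U),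
      ringKrullDim (Γ(X, U) ⧸ (hU.primeIdealOf ⟨x, hx⟩).asIdeal) = n := by
  let _ : Algebra k (X.presheaf.stalk x) := (DCI.toStalk f x).toAlgebra
  refine ⟨Cardinal.toNat (Algebra.trdeg k (IsLocalRing.ResidueField (X.presheaf.stalk x))),
    fun U hU hx => ?_⟩
  let _ : Algebra k Γ(X, U) := (DCI.toSec f U).toAlgebra
  have : Algebra.FiniteType k Γ(X, U) := DCI.toSec_ft f U hU
  let _ : Algebra Γ(X, U) (X.presheaf.stalk x) := (X.presheaf.germ U x hx).hom.toAlgebra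
  have : IsScalarTower k Γ(X, U) (X.presheaf.stalk x) :=
    IsScalarTower.of_algebraMap_eq' (DCI.germ_toSec f U x hx).symm
  have : IsLocalization.AtPrime (X.presheaf.stalk x) (hU.primeIdealOf ⟨x, hx⟩).asIdeal :=
    hU.isLocalization_stalk ⟨x, hx⟩
  obtain ⟨n, hn, hn'⟩ := DCI.dim_local (k := k) (S := X.presheaf.stalk x)
    (hU.primeIdealOf ⟨x, hx⟩).asIdeal
  rw [hn, hn']; simp

theorem DCI.spec_iff {X : Scheme.{0}} (x : X) (U : X.Opens) (hU : IsAffineOpen U) (hx : x ∈ U)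
    (y : PrimeSpectrum Γ(X, U)) :
    (hU.primeIdealOf ⟨x, hx⟩).asIdeal ≤ y.asIdeal ↔ x ⤳ hU.fromSpec y := by
  have h1 : hU.fromSpec (hU.primeIdealOf ⟨x, hx⟩) = x := hU.fromSpec_primeIdealOf ⟨x, hx⟩
  have h2 := hU.fromSpec.isOpenEmbedding.isInducing.specializes_iff
    (x := hU.primeIdealOf ⟨x, hx⟩) (y := y)
  rw [h1] at h2
  exact (PrimeSpectrum.le_iff_specializes _ _).trans h2.symm

theorem DCI.dim_preimage {X : Scheme.{0}} (x : X) (U : X.Opens) (hU : IsAffineOpen U) (hx : x ∈ U) :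
    topologicalKrullDim (hU.fromSpec ⁻¹' (closure {x})) =
      ringKrullDim (Γ(X, U) ⧸ (hU.primeIdealOf ⟨x, hx⟩).asIdeal) := by
  set p := (hU.primeIdealOf ⟨x, hx⟩).asIdeal
  rw [← PrimeSpectrum.topologicalKrullDim_eq_ringKrullDim]
  have hr : hU.fromSpec ⁻¹' (closure {x}) =
      Set.range (PrimeSpectrum.comap (Ideal.Quotient.mk p)) := by
    rw [_root_.range_comap_of_surjective _ _ Ideal.Quotient.mk_surjective, Ideal.mk_ker]
    ext y
    rw [Set.mem_preimage, ← specializes_iff_mem_closure, ← DCI.spec_iff x U hU hx y]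
    rfl
  rw [hr]
  have he := (PrimeSpectrum.isClosedEmbedding_comap_of_surjective _ (Ideal.Quotient.mk p)
    Ideal.Quotient.mk_surjective).isEmbedding
  exact (IsHomeomorph.topologicalKrullDim_eq _ he.toHomeomorph.isHomeomorph).symm

theorem DCI.dim_closure_le {X : Scheme.{0}} (x : X) (n : ℕ)
    (hn : ∀ (U : X.Opens) (hU : IsAffineOpen U) (hx : x ∈ U),
      ringKrullDim (Γ(X, U) ⧸ (hU.primeIdealOf ⟨x, hx⟩).asIdeal) = n) :
    topologicalKrullDim (closure {x} : Set X) ≤ n := by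
  refine DCI.dim_le_of_cover _ ?_
  rintro ⟨z, hz⟩
  obtain ⟨U, hU, hzU, -⟩ := exists_isAffineOpen_mem_and_subset (U := (⊤ : X.Opens)) (x := z) trivial
  have hx : x ∈ U := (specializes_iff_mem_closure.mpr hz).mem_open U.2 hzU
  refine ⟨hU.fromSpec ⁻¹' (closure {x}), inferInstance, Set.restrictPreimage _ hU.fromSpec,
    hU.fromSpec.isOpenEmbedding.restrictPreimage _, ?_, ?_⟩
  · rw [Set.range_restrictPreimage]
    show z ∈ Set.range hU.fromSpec
    rw [hU.range_fromSpec]; exact hzU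
  · rw [DCI.dim_preimage x U hU hx, hn U hU hx]

theorem dim_component_of_intersection_ge
    (k : Type) [Field k] [IsAlgClosed k]
    (X : Scheme) (f : X ⟶ Spec (CommRingCat.of k)) [LocallyOfFiniteType f]
    (Z₁ Z₂ : Set X) (hZ₁c : IsClosed Z₁) (hZ₂c : IsClosed Z₂)
    (hZ₁i : IsIrreducible Z₁) (hZ₂i : IsIrreducible Z₂)
    (d₁ d₂ : ℕ) (hd₁ : topologicalKrullDim Z₁ = d₁) (hd₂ : topologicalKrullDim Z₂ = d₂)
    (P : X) (hPc : IsClosed ({P} : Set X)) (hP : P ∈ Z₁ ∩ Z₂)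
    -- `d` is the dimension of the Zariski tangent space of `X` at `P`, the dual over the
    -- residue field of `m_P / m_P²`
    (d : ℕ)
    (hd : Module.finrank (IsLocalRing.ResidueField (X.presheaf.stalk P))
      (Module.Dual (IsLocalRing.ResidueField (X.presheaf.stalk P))
        (IsLocalRing.CotangentSpace (X.presheaf.stalk P))) = d)
    -- `W` is an irreducible component of `Z₁ ∩ Z₂` containing `P`
    (W : Set X) (hWi : IsIrreducible W) (hWsub : W ⊆ Z₁ ∩ Z₂)
    (hWmax : ∀ W' : Set X, IsIrreducible W' → W' ⊆ Z₁ ∩ Z₂ → W ⊆ W' → W' = W)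
    (hPW : P ∈ W) :
    (d₁ + d₂ : WithBot ℕ∞) ≤ topologicalKrullDim W + d := by
  have hWc : IsClosed W := by
    have := hWmax (closure W) hWi.closure
      (closure_minimal hWsub (hZ₁c.inter hZ₂c)) subset_closure
    rw [← this]; exact isClosed_closure
  obtain ⟨η₁, hη₁⟩ := QuasiSober.sober hZ₁i hZ₁c
  obtain ⟨η₂, hη₂⟩ := QuasiSober.sober hZ₂i hZ₂c
  obtain ⟨ω, hω⟩ := QuasiSober.sober hWi hWc
  have hmem₁ : ∀ x, x ∈ Z₁ ↔ η₁ ⤳ x := fun x => by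
    rw [specializes_iff_mem_closure, hη₁.def]
  have hmem₂ : ∀ x, x ∈ Z₂ ↔ η₂ ⤳ x := fun x => by
    rw [specializes_iff_mem_closure, hη₂.def]
  have hmemW : ∀ x, x ∈ W ↔ ω ⤳ x := fun x => by
    rw [specializes_iff_mem_closure, hω.def]
  obtain ⟨U, hU, hPU, -⟩ := exists_isAffineOpen_mem_and_subset (U := (⊤ : X.Opens)) (x := P) trivial
  have h1U : η₁ ∈ U := ((hmem₁ P).mp hP.1).mem_open U.2 hPU
  have h2U : η₂ ∈ U := ((hmem₂ P).mp hP.2).mem_open U.2 hPU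
  have hωU : ω ∈ U := ((hmemW P).mp hPW).mem_open U.2 hPU
  have hωW : ω ∈ W := hω.mem
  obtain ⟨n₁, hn₁⟩ := DCI.dim_affine f η₁
  obtain ⟨n₂, hn₂⟩ := DCI.dim_affine f η₂
  have hle₁ : (d₁ : WithBot ℕ∞) ≤ n₁ := by
    rw [← hd₁, ← hη₁.def]; exact DCI.dim_closure_le η₁ n₁ hn₁
  have hle₂ : (d₂ : WithBot ℕ∞) ≤ n₂ := by
    rw [← hd₂, ← hη₂.def]; exact DCI.dim_closure_le η₂ n₂ hn₂
  set yP := hU.primeIdealOf ⟨P, hPU⟩ with hyP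
  set y₁ := hU.primeIdealOf ⟨η₁, h1U⟩ with hy₁
  set y₂ := hU.primeIdealOf ⟨η₂, h2U⟩ with hy₂
  set yW := hU.primeIdealOf ⟨ω, hωU⟩ with hyW
  have hjP : hU.fromSpec yP = P := hU.fromSpec_primeIdealOf ⟨P, hPU⟩
  have hjW : hU.fromSpec yW = ω := hU.fromSpec_primeIdealOf ⟨ω, hωU⟩
  have hmax : yP.asIdeal.IsMaximal := hU.primeIdealOf_isMaximal_of_isClosed ⟨P, hPU⟩ hPc
  have hqm : yW.asIdeal ≤ yP.asIdeal := by
    rw [hyW, DCI.spec_iff ω U hU hωU yP, hjP]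
    exact (hmemW P).mp hPW
  have hq : yW.asIdeal ∈ (y₁.asIdeal ⊔ y₂.asIdeal).minimalPrimes := by
    refine ⟨⟨yW.2, sup_le ?_ ?_⟩, ?_⟩
    · rw [hy₁, DCI.spec_iff η₁ U hU h1U yW, hjW]
      exact (hmem₁ ω).mp (hWsub hωW).1
    · rw [hy₂, DCI.spec_iff η₂ U hU h2U yW, hjW]
      exact (hmem₂ ω).mp (hWsub hωW).2
    · rintro q' ⟨hq'p, hq'⟩ hq'le
      let y' : PrimeSpectrum Γ(X, U) := ⟨q', hq'p⟩
      let z : X := hU.fromSpec y'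
      have hz1 : z ∈ Z₁ := (hmem₁ z).mpr
        ((DCI.spec_iff η₁ U hU h1U y').mp (le_sup_left.trans hq'))
      have hz2 : z ∈ Z₂ := (hmem₂ z).mpr
        ((DCI.spec_iff η₂ U hU h2U y').mp (le_sup_right.trans hq'))
      have hzω : z ⤳ ω := by
        have h3 := hU.fromSpec.isOpenEmbedding.isInducing.specializes_iff (x := y') (y := yW)
        rw [hjW] at h3
        exact h3.mpr ((PrimeSpectrum.le_iff_specializes y' yW).mp hq'le)
      have hW' := hWmax (closure {z}) isIrreducible_singleton.closure
        (closure_minimal (by rintro _ rfl; exact ⟨hz1, hz2⟩) (hZ₁c.inter hZ₂c)) (by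
          rw [← hω.def]
          refine closure_minimal ?_ isClosed_closure
          rintro _ rfl
          exact specializes_iff_mem_closure.mp hzω)
      have hzW : z ∈ W := hW' ▸ subset_closure rfl
      exact (DCI.spec_iff ω U hU hωU y').mpr ((hmemW z).mp hzW)
  have hdimW : ringKrullDim (Γ(X, U) ⧸ yW.asIdeal) ≤ topologicalKrullDim W := by
    rw [← DCI.dim_preimage ω U hU hωU, hω.def]
    exact (hU.fromSpec.isOpenEmbedding.restrictPreimage W).isInducing.topologicalKrullDim_le
  rw [Subspace.dual_finrank_eq] at hd
  let _ : Algebra k Γ(X, U) := (DCI.toSec f U).toAlgebra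
  have : Algebra.FiniteType k Γ(X, U) := DCI.toSec_ft f U hU
  let _ : Algebra Γ(X, U) (X.presheaf.stalk P) := (X.presheaf.germ U P hPU).hom.toAlgebra
  have : IsLocalization.AtPrime (X.presheaf.stalk P) yP.asIdeal :=
    hU.isLocalization_stalk ⟨P, hPU⟩
  have hmain := DCI.algebra_main (k := k) (S := X.presheaf.stalk P) yP.asIdeal d hd
    y₁.asIdeal y₂.asIdeal yW.asIdeal hq hqm
  rw [hn₁ U hU h1U, hn₂ U hU h2U] at hmain
  calc (d₁ + d₂ : WithBot ℕ∞) ≤ n₁ + n₂ := add_le_add hle₁ hle₂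
    _ ≤ _ := hmain
    _ ≤ _ := by gcongr
end

section
/- Let T = k[α_1, α_2] and let I be a monomial ideal with dim_k T/I = r for a positive integer r. Write the minimal monomial generators of I as α_1^{a_0}, α_1^{a_1}α_2^{b_1}, …, α_2^{b_m}, where a_0 > a_1 > ⋯ > a_m = 0 and 0 = b_0 < b_1 < ⋯ < b_m. For an integer a, let λ(a) be the number of monomials of degree a not belonging to I. Then Σ_{c>0} dim_k Hom_T(I, T/I)_c = Σ_{i=0}^{m} Σ_{a > a_i+b_i} λ(a) − Σ_{i=1}^{m} Σ_{a > a_{i−1}+b_i} λ(a). -/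
open MvPolynomial

/-- The degree-`d` graded piece of `T/I`, where `T = k[α₁, α₂]`. -/
noncomputable def quotPieceT (k : Type*) [Field k]
    (I : Ideal (MvPolynomial (Fin 2) k)) (d : ℕ) :
    Submodule k (MvPolynomial (Fin 2) k ⧸ I) :=
  (homogeneousSubmodule (Fin 2) k d).map (Ideal.Quotient.mkₐ k I).toLinearMap

/-- The `k`-vector space `Hom_T(I, T/I)_c` of `T`-module homomorphisms `I → T/I`
raising degrees by `c`. -/
noncomputable def HomC (k : Type*) [Field k]
    (I : Ideal (MvPolynomial (Fin 2) k)) (c : ℕ) :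
    Submodule k ((↥I) →ₗ[MvPolynomial (Fin 2) k] (MvPolynomial (Fin 2) k ⧸ I)) where
  carrier := {φ | ∀ (d : ℕ) (f : ↥I), (f : MvPolynomial (Fin 2) k).IsHomogeneous d →
    φ f ∈ quotPieceT k I (d + c)}
  add_mem' := fun h1 h2 d f hf => by
    simpa using Submodule.add_mem _ (h1 d f hf) (h2 d f hf)
  zero_mem' := fun d f hf => by simp
  smul_mem' := fun r φ h d f hf => by
    simpa using Submodule.smul_mem _ r (h d f hf)

/-- `λ(deg)`: the number of monomials of degree `deg` not belonging to `I`
(with `α₁ = X 0`, `α₂ = X 1`). -/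
noncomputable def lam (k : Type*) [Field k]
    (I : Ideal (MvPolynomial (Fin 2) k)) (deg : ℕ) : ℕ :=
  Set.ncard {s : ℕ | s ≤ deg ∧ X 0 ^ s * X 1 ^ (deg - s) ∉ I}


namespace HomCalc

variable {k : Type*} [Field k]

/-- The monomial `α₁^s α₂^t`. -/
noncomputable def mon (k : Type*) [Field k] (s t : ℕ) : MvPolynomial (Fin 2) k := X 0 ^ s * X 1 ^ t

/-- The exponent vector `(s,t)`. -/
noncomputable def ev (s t : ℕ) : Fin 2 →₀ ℕ := Finsupp.single 0 s + Finsupp.single 1 t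

@[simp] lemma ev_zero (s t : ℕ) : ev s t 0 = s := by simp [ev]
@[simp] lemma ev_one (s t : ℕ) : ev s t 1 = t := by simp [ev]

lemma ev_self (μ : Fin 2 →₀ ℕ) : ev (μ 0) (μ 1) = μ := by
  ext i; fin_cases i <;> simp

lemma ev_le (s t : ℕ) (μ : Fin 2 →₀ ℕ) : ev s t ≤ μ ↔ s ≤ μ 0 ∧ t ≤ μ 1 := by
  rw [Finsupp.le_def]
  constructor
  · intro h; exact ⟨by simpa using h 0, by simpa using h 1⟩
  · rintro ⟨h0, h1⟩ i
    fin_cases i <;> simpa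

lemma mon_eq (s t : ℕ) : mon k s t = monomial (ev s t) 1 := by
  simp [mon, ev, X_pow_eq_monomial, monomial_mul]

lemma mon_mul (s t s' t' : ℕ) : mon k s t * mon k s' t' = mon k (s + s') (t + t') := by
  simp only [mon]; ring

lemma mon_hom (s t : ℕ) : (mon k s t).IsHomogeneous (s + t) := by
  simpa [mon] using ((isHomogeneous_X k (0 : Fin 2)).pow s).mul ((isHomogeneous_X k (1 : Fin 2)).pow t)

lemma hom_span (d : ℕ) : homogeneousSubmodule (Fin 2) k d =
    Submodule.span k ((fun s => mon k s (d - s)) '' Set.Iic d) := by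
  apply le_antisymm
  · intro f hf
    rw [mem_homogeneousSubmodule] at hf
    rw [f.as_sum]
    refine Submodule.sum_mem _ fun μ hμ => ?_
    have hd : μ 0 + μ 1 = d := by
      have := hf (mem_support_iff.mp hμ)
      simpa [Finsupp.weight_apply, Finsupp.sum_fintype] using this
    have : monomial μ (coeff μ f) = coeff μ f • mon k (μ 0) (d - μ 0) := by
      rw [mon_eq, show d - μ 0 = μ 1 by omega, ev_self, smul_monomial]; simp
    rw [this]
    exact Submodule.smul_mem _ _ (Submodule.subset_span ⟨μ 0, by simp; omega, rfl⟩)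
  · rw [Submodule.span_le]
    rintro _ ⟨s, hs, rfl⟩
    have := mon_hom (k := k) s (d - s)
    rw [Nat.add_sub_cancel' hs] at this
    exact this

lemma hom_split (A B c : ℕ) (G : MvPolynomial (Fin 2) k) (hG : G.IsHomogeneous (A + B + c)) :
    ∃ p q : MvPolynomial (Fin 2) k, p.IsHomogeneous (B + c) ∧ q.IsHomogeneous (A + c) ∧
      G = X 0 ^ A * p + X 1 ^ B * q := by
  have h : G ∈ homogeneousSubmodule (Fin 2) k (A + B + c) := hG
  rw [hom_span] at h
  clear hG
  induction h using Submodule.span_induction with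
  | mem x hx =>
    obtain ⟨s, hs, rfl⟩ := hx
    simp only [Set.mem_Iic] at hs
    by_cases hA : A ≤ s
    · refine ⟨mon k (s - A) (A + B + c - s), 0, ?_, isHomogeneous_zero _ _ _, ?_⟩
      · convert mon_hom (k := k) (s - A) (A + B + c - s) using 1; omega
      · obtain ⟨u, rfl⟩ := Nat.exists_eq_add_of_le hA
        simp [mon, pow_add, mul_assoc]
    · refine ⟨0, mon k s (A + c - s), isHomogeneous_zero _ _ _, ?_, ?_⟩
      · convert mon_hom (k := k) s (A + c - s) using 1; omega
      · have : A + B + c - s = B + (A + c - s) := by omega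
        simp only [mon, this, pow_add]; ring
  | zero => exact ⟨0, 0, isHomogeneous_zero _ _ _, isHomogeneous_zero _ _ _, by simp⟩
  | add x y _ _ hx hy =>
    obtain ⟨p, q, hp, hq, rfl⟩ := hx
    obtain ⟨p', q', hp', hq', rfl⟩ := hy
    exact ⟨p + p', q + q', hp.add hp', hq.add hq', by ring⟩
  | smul r x _ hx =>
    obtain ⟨p, q, hp, hq, rfl⟩ := hx
    refine ⟨C r * p, C r * q, ?_, ?_, ?_⟩
    · simpa using (isHomogeneous_C (Fin 2) r).mul hp
    · simpa using (isHomogeneous_C (Fin 2) r).mul hq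
    · rw [smul_eq_C_mul]; ring

/-- Membership in a monomial ideal. -/
lemma mem_iff (m : ℕ) (a b : ℕ → ℕ) (I : Ideal (MvPolynomial (Fin 2) k))
    (hI : I = Ideal.span ((fun i => X 0 ^ a i * X 1 ^ b i) '' Set.Iic m))
    (f : MvPolynomial (Fin 2) k) :
    f ∈ I ↔ ∀ μ ∈ f.support, ∃ i ≤ m, a i ≤ μ 0 ∧ b i ≤ μ 1 := by
  have : ((fun i => X 0 ^ a i * X 1 ^ b i) '' Set.Iic m : Set (MvPolynomial (Fin 2) k)) =
      (fun s => monomial s 1) '' ((fun i => ev (a i) (b i)) '' Set.Iic m) := by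
    rw [Set.image_image]
    apply Set.image_congr
    intro i _
    exact mon_eq _ _
  rw [hI, this, mem_ideal_span_monomial_image]
  simp [ev_le]

lemma mon_mem_iff (m : ℕ) (a b : ℕ → ℕ) (I : Ideal (MvPolynomial (Fin 2) k))
    (hI : I = Ideal.span ((fun i => X 0 ^ a i * X 1 ^ b i) '' Set.Iic m)) (s t : ℕ) :
    mon k s t ∈ I ↔ ∃ i ≤ m, a i ≤ s ∧ b i ≤ t := by
  classical
  rw [mem_iff m a b I hI, mon_eq]
  simp [support_monomial]

lemma finrank_quotPiece (m : ℕ) (a b : ℕ → ℕ) (I : Ideal (MvPolynomial (Fin 2) k))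
    (hI : I = Ideal.span ((fun i => X 0 ^ a i * X 1 ^ b i) '' Set.Iic m)) (d : ℕ) :
    Module.finrank k (quotPieceT k I d) = lam k I d := by
  classical
  set S : Set ℕ := {s : ℕ | s ≤ d ∧ X 0 ^ s * X 1 ^ (d - s) ∉ I} with hS
  have hfin : S.Finite := (Set.finite_Iic d).subset fun s hs => hs.1
  have : Fintype S := hfin.fintype
  let v : S → MvPolynomial (Fin 2) k ⧸ I := fun s => Ideal.Quotient.mkₐ k I (mon k s (d - s))
  have hli : LinearIndependent k v := by
    rw [Fintype.linearIndependent_iff]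
    intro g hg s
    have h1 : Ideal.Quotient.mkₐ k I (∑ s : S, g s • mon k s (d - s)) = 0 := by
      rw [map_sum]; simpa [v] using hg
    have h2 : (∑ s : S, g s • mon k s (d - s)) ∈ I := by
      rwa [Ideal.Quotient.mkₐ_eq_mk, Ideal.Quotient.eq_zero_iff_mem] at h1
    by_contra hne
    have hc : coeff (ev s (d - s)) (∑ s : S, g s • mon k s (d - s)) = g s := by
      rw [coeff_sum, Finset.sum_eq_single s]
      · simp [mon_eq]
      · intro t _ hts
        rw [coeff_smul, mon_eq, coeff_monomial, if_neg, smul_zero]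
        intro h
        apply hts
        have := congrArg (fun μ : Fin 2 →₀ ℕ => μ 0) h
        exact Subtype.ext (by simpa using this)
      · simp
    have h3 := (mem_iff m a b I hI _).mp h2 (ev s (d - s)) (by rw [mem_support_iff, hc]; exact hne)
    apply s.2.2
    have := (mon_mem_iff m a b I hI s (d - s)).mpr (by simpa using h3)
    exact this
  have hsp : quotPieceT k I d = Submodule.span k (Set.range v) := by
    rw [quotPieceT, hom_span, Submodule.map_span]
    apply le_antisymm
    · rw [Submodule.span_le]
      rintro _ ⟨_, ⟨s, hs, rfl⟩, rfl⟩
      by_cases h : mon k s (d - s) ∈ I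
      · have : (Ideal.Quotient.mkₐ k I).toLinearMap (mon k s (d - s)) = 0 := by
          simpa using Ideal.Quotient.eq_zero_iff_mem.mpr h
        simp only [this]
        exact Submodule.zero_mem _
      · exact Submodule.subset_span ⟨⟨s, hs, h⟩, rfl⟩
    · apply Submodule.span_mono
      rintro _ ⟨s, rfl⟩
      exact ⟨_, ⟨s, s.2.1, rfl⟩, rfl⟩
  rw [hsp, finrank_span_eq_card hli, lam, Set.ncard_eq_toFinset_card', Set.toFinset_card]

lemma lam_zero (m : ℕ) (a b : ℕ → ℕ) (ham : a m = 0) (hb0 : b 0 = 0)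
    (I : Ideal (MvPolynomial (Fin 2) k))
    (hI : I = Ideal.span ((fun i => X 0 ^ a i * X 1 ^ b i) '' Set.Iic m)) (d : ℕ)
    (hd : a 0 + b m ≤ d) : lam k I d = 0 := by
  have : {s : ℕ | s ≤ d ∧ X 0 ^ s * X 1 ^ (d - s) ∉ I} = ∅ := by
    ext s
    simp only [Set.mem_ofPred_eq, Set.mem_empty_iff_false, iff_false, not_and, not_not]
    intro hs
    refine (mon_mem_iff m a b I hI s (d - s)).mpr ?_
    by_cases h : a 0 ≤ s
    · exact ⟨0, by omega, h, by omega⟩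
    · exact ⟨m, le_rfl, by omega, by omega⟩
  rw [lam, this, Set.ncard_empty]

end HomCalc

namespace HomCalc

variable {k : Type*} [Field k]

lemma mem_quotPiece (I : Ideal (MvPolynomial (Fin 2) k)) (d : ℕ) (q : MvPolynomial (Fin 2) k ⧸ I) :
    q ∈ quotPieceT k I d ↔ ∃ p : MvPolynomial (Fin 2) k, p.IsHomogeneous d ∧
      Ideal.Quotient.mk I p = q := by
  rw [quotPieceT, Submodule.mem_map]
  rfl

lemma mul_mem_quotPiece (I : Ideal (MvPolynomial (Fin 2) k)) (d e n : ℕ)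
    (p : MvPolynomial (Fin 2) k) (hp : p.IsHomogeneous e)
    (q : MvPolynomial (Fin 2) k ⧸ I) (hq : q ∈ quotPieceT k I d) (hn : e + d = n) :
    Ideal.Quotient.mk I p * q ∈ quotPieceT k I n := by
  rw [mem_quotPiece] at hq ⊢
  obtain ⟨q, hq, rfl⟩ := hq
  exact ⟨p * q, hn ▸ hp.mul hq, map_mul _ _ _⟩

lemma anti_of (m : ℕ) (a : ℕ → ℕ) (ha : ∀ i < m, a (i+1) < a i) (i j : ℕ) (hij : i ≤ j)
    (hj : j ≤ m) : a j ≤ a i := by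
  induction j, hij using Nat.le_induction with
  | base => exact le_rfl
  | succ n hn ih => exact (ha n (by omega)).le.trans (ih (by omega))

lemma mono_of (m : ℕ) (b : ℕ → ℕ) (hb : ∀ i < m, b i < b (i+1)) (i j : ℕ) (hij : i ≤ j)
    (hj : j ≤ m) : b i ≤ b j := by
  induction j, hij using Nat.le_induction with
  | base => exact le_rfl
  | succ n hn ih => exact (ih (by omega)).trans (hb n (by omega)).le

lemma chain (m : ℕ) (a b : ℕ → ℕ)
    (ha : ∀ i < m, a (i+1) < a i) (hb : ∀ i < m, b i < b (i+1))
    (I : Ideal (MvPolynomial (Fin 2) k)) (f : ℕ → MvPolynomial (Fin 2) k ⧸ I)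
    (hf : ∀ j < m, Ideal.Quotient.mk I (X 1 ^ (b (j+1) - b j)) * f j =
      Ideal.Quotient.mk I (X 0 ^ (a j - a (j+1))) * f (j+1))
    (i j : ℕ) (hij : i ≤ j) (hj : j ≤ m) (s t : ℕ) (hs : a i ≤ s) (ht : b j ≤ t) :
    Ideal.Quotient.mk I (mon k (s - a i) (t - b i)) * f i =
      Ideal.Quotient.mk I (mon k (s - a j) (t - b j)) * f j := by
  induction j, hij using Nat.le_induction with
  | base => rfl
  | succ n hn ih =>
    have hbn := hb n (by omega)
    have han := ha n (by omega)
    have hani := anti_of m a ha i n hn (by omega)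
    rw [ih (by omega) (by omega)]
    have e1 : mon k (s - a n) (t - b n) =
        mon k (s - a n) (t - b (n+1)) * X 1 ^ (b (n+1) - b n) := by
      rw [mon, mon, mul_assoc, ← pow_add]; congr 2; omega
    have e2 : mon k (s - a (n+1)) (t - b (n+1)) =
        mon k (s - a n) (t - b (n+1)) * X 0 ^ (a n - a (n+1)) := by
      rw [mon, mon, mul_right_comm, ← pow_add]; congr 2; omega
    rw [e1, e2, map_mul, map_mul, mul_assoc, hf n (by omega), mul_assoc]

lemma chain' (m : ℕ) (a b : ℕ → ℕ)
    (ha : ∀ i < m, a (i+1) < a i) (hb : ∀ i < m, b i < b (i+1))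
    (I : Ideal (MvPolynomial (Fin 2) k)) (f : ℕ → MvPolynomial (Fin 2) k ⧸ I)
    (hf : ∀ j < m, Ideal.Quotient.mk I (X 1 ^ (b (j+1) - b j)) * f j =
      Ideal.Quotient.mk I (X 0 ^ (a j - a (j+1))) * f (j+1))
    (i j : ℕ) (hi : i ≤ m) (hj : j ≤ m) (s t : ℕ) (hs : a i ≤ s) (ht : b j ≤ t)
    (hs' : a j ≤ s) (ht' : b i ≤ t) :
    Ideal.Quotient.mk I (mon k (s - a i) (t - b i)) * f i =
      Ideal.Quotient.mk I (mon k (s - a j) (t - b j)) * f j := by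
  rcases le_total i j with h | h
  · exact chain m a b ha hb I f hf i j h hj s t hs ht
  · exact (chain m a b ha hb I f hf j i h hi s t hs' ht').symm

lemma gen_mem (m : ℕ) (a b : ℕ → ℕ) (I : Ideal (MvPolynomial (Fin 2) k))
    (hI : I = Ideal.span ((fun i => X 0 ^ a i * X 1 ^ b i) '' Set.Iic m)) (i : ℕ) (hi : i ≤ m) :
    mon k (a i) (b i) ∈ I :=
  (mon_mem_iff m a b I hI _ _).mpr ⟨i, hi, le_rfl, le_rfl⟩

lemma exists_hom (m : ℕ) (a b : ℕ → ℕ)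
    (ha : ∀ i < m, a (i+1) < a i) (hb : ∀ i < m, b i < b (i+1))
    (I : Ideal (MvPolynomial (Fin 2) k))
    (hI : I = Ideal.span ((fun i => X 0 ^ a i * X 1 ^ b i) '' Set.Iic m))
    (f : ℕ → MvPolynomial (Fin 2) k ⧸ I)
    (hf : ∀ j < m, Ideal.Quotient.mk I (X 1 ^ (b (j+1) - b j)) * f j =
      Ideal.Quotient.mk I (X 0 ^ (a j - a (j+1))) * f (j+1))
    (c : ℕ) (hc : ∀ i ≤ m, f i ∈ quotPieceT k I (a i + b i + c)) :
    ∃ φ ∈ HomC k I c, ∀ i ≤ m, ∀ h : mon k (a i) (b i) ∈ I, φ ⟨mon k (a i) (b i), h⟩ = f i := by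
  classical
  let F : (Fin 2 →₀ ℕ) → MvPolynomial (Fin 2) k ⧸ I := fun μ =>
    if h : ∃ i ≤ m, a i ≤ μ 0 ∧ b i ≤ μ 1 then
      Ideal.Quotient.mk I (mon k (μ 0 - a h.choose) (μ 1 - b h.choose)) * f h.choose else 0
  have hF : ∀ (s t i : ℕ), i ≤ m → a i ≤ s → b i ≤ t →
      F (ev s t) = Ideal.Quotient.mk I (mon k (s - a i) (t - b i)) * f i := by
    intro s t i hi hs ht
    have h : ∃ i ≤ m, a i ≤ ev s t 0 ∧ b i ≤ ev s t 1 := ⟨i, hi, by simpa, by simpa⟩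
    have h' := h.choose_spec
    simp only [F, dif_pos h]
    simp only [ev_zero, ev_one] at h' ⊢
    exact chain' m a b ha hb I f hf _ _ h'.1 hi s t h'.2.1 ht hs h'.2.2
  let ψ : MvPolynomial (Fin 2) k →ₗ[k] MvPolynomial (Fin 2) k ⧸ I :=
    (basisMonomials (Fin 2) k).constr k F
  have hψ : ∀ s t, ψ (mon k s t) = F (ev s t) := by
    intro s t
    have := (basisMonomials (Fin 2) k).constr_basis k F (ev s t)
    rw [coe_basisMonomials] at this
    rw [mon_eq]
    exact this
  have hψg : ∀ i ≤ m, ∀ h : MvPolynomial (Fin 2) k,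
      ψ (h * mon k (a i) (b i)) = Ideal.Quotient.mk I h * f i := by
    intro i hi h
    induction h using MvPolynomial.induction_on' with
    | monomial μ r =>
      have : monomial μ r = r • mon k (μ 0) (μ 1) := by
        rw [mon_eq, ev_self, smul_monomial]; simp
      rw [this, smul_mul_assoc, map_smul, mon_mul, hψ, hF _ _ i hi (by omega) (by omega)]
      rw [← Ideal.Quotient.mkₐ_eq_mk k, map_smul, smul_mul_assoc]
      simp
    | add p q hp hq => rw [add_mul, map_add, hp, hq, map_add, add_mul]
  have hlin : ∀ g ∈ I, ∀ t, ψ (t * g) = Ideal.Quotient.mk I t * ψ g := by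
    intro g hg
    have hg' : g ∈ Ideal.span ((fun i => X 0 ^ a i * X 1 ^ b i) '' Set.Iic m) := hI ▸ hg
    clear hg
    induction hg' using Submodule.span_induction with
    | mem x hx =>
      obtain ⟨i, hi, rfl⟩ := hx
      intro t
      have h1 := hψg i hi 1
      rw [one_mul, map_one, one_mul] at h1
      change ψ (t * mon k (a i) (b i)) = _ * ψ (mon k (a i) (b i))
      rw [h1, hψg i hi]
    | zero => simp
    | add x y _ _ hx hy => intro t; rw [mul_add, map_add, hx, hy, map_add, mul_add]
    | smul r x _ hx =>
      intro t
      rw [smul_eq_mul, ← mul_assoc, hx, hx, map_mul, mul_assoc]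
  have hdeg : ∀ d, ∀ g : MvPolynomial (Fin 2) k, g.IsHomogeneous d →
      ψ g ∈ quotPieceT k I (d + c) := by
    intro d g hg
    have h : g ∈ homogeneousSubmodule (Fin 2) k d := hg
    rw [hom_span] at h
    suffices hs : Submodule.span k ((fun s => mon k s (d - s)) '' Set.Iic d) ≤
        (quotPieceT k I (d + c)).comap ψ from hs h
    rw [Submodule.span_le]
    rintro _ ⟨s, hs, rfl⟩
    simp only [Set.mem_Iic] at hs
    change ψ (mon k s (d - s)) ∈ quotPieceT k I (d + c)
    rw [hψ]
    by_cases hi : ∃ i ≤ m, a i ≤ s ∧ b i ≤ d - s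
    · obtain ⟨i, hi, h1, h2⟩ := hi
      rw [hF _ _ i hi h1 h2]
      exact mul_mem_quotPiece I _ _ _ _ (mon_hom _ _) _ (hc i hi) (by omega)
    · have : F (ev s (d - s)) = 0 := by
        simp only [F]
        rw [dif_neg]
        simpa using hi
      rw [this]
      exact Submodule.zero_mem _
  let φ : (↥I) →ₗ[MvPolynomial (Fin 2) k] (MvPolynomial (Fin 2) k ⧸ I) :=
    { toFun := fun g => ψ g
      map_add' := fun x y => by simp
      map_smul' := fun t g => by
        simp only [RingHom.id_apply, Submodule.coe_smul, smul_eq_mul]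
        rw [hlin g g.2 t]
        rfl }
  refine ⟨φ, fun d g hg => hdeg d g hg, fun i hi h => ?_⟩
  change ψ (mon k (a i) (b i)) = f i
  simpa using hψg i hi 1

lemma surj (m : ℕ) (a b : ℕ → ℕ)
    (ha : ∀ i < m, a (i+1) < a i) (hb : ∀ i < m, b i < b (i+1))
    (c : ℕ) (G : ℕ → MvPolynomial (Fin 2) k)
    (hG : ∀ j < m, (G j).IsHomogeneous (a j + b (j+1) + c)) :
    ∃ f : ℕ → MvPolynomial (Fin 2) k, (∀ i ≤ m, (f i).IsHomogeneous (a i + b i + c)) ∧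
      ∀ j < m, X 1 ^ (b (j+1) - b j) * f j - X 0 ^ (a j - a (j+1)) * f (j+1) = G j := by
  have h : ∀ j, ∃ pq : MvPolynomial (Fin 2) k × MvPolynomial (Fin 2) k, j < m →
      pq.1.IsHomogeneous (b (j+1) + c) ∧ pq.2.IsHomogeneous (a j + c) ∧
      G j = X 0 ^ a j * pq.1 + X 1 ^ b (j+1) * pq.2 := by
    intro j
    by_cases hj : j < m
    · obtain ⟨p, q, h⟩ := hom_split _ _ _ _ (hG j hj)
      exact ⟨(p, q), fun _ => h⟩
    · exact ⟨0, fun h => absurd h hj⟩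
  choose pq hpq using h
  have hXpow : ∀ (i : Fin 2) (n : ℕ), (X i ^ n : MvPolynomial (Fin 2) k).IsHomogeneous n := by
    intro i n
    simpa using (isHomogeneous_X k i).pow n
  -- upward recursion for the `X 0` part
  have hU : ∃ u : ℕ → MvPolynomial (Fin 2) k, (∀ i ≤ m, (u i).IsHomogeneous (b i + c)) ∧
      ∀ j, u (j+1) = X 1 ^ (b (j+1) - b j) * u j - (pq j).1 := by
    let u : ℕ → MvPolynomial (Fin 2) k :=
      fun n => Nat.rec 0 (fun j r => X 1 ^ (b (j+1) - b j) * r - (pq j).1) n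
    refine ⟨u, ?_, fun j => rfl⟩
    intro i
    induction i with
    | zero => intro _; exact isHomogeneous_zero _ _ _
    | succ n ih =>
      intro hn
      have hbn := hb n (by omega)
      change (X 1 ^ (b (n+1) - b n) * u n - (pq n).1).IsHomogeneous _
      refine IsHomogeneous.sub ?_ (hpq n (by omega)).1
      have := (hXpow 1 (b (n+1) - b n)).mul (ih (by omega))
      rwa [show b (n+1) - b n + (b n + c) = b (n+1) + c by omega] at this
  -- downward recursion for the `X 1` part
  have hV : ∃ v : ℕ → MvPolynomial (Fin 2) k, (∀ i ≤ m, (v i).IsHomogeneous (a i + c)) ∧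
      ∀ j < m, v j = X 0 ^ (a j - a (j+1)) * v (j+1) + (pq j).2 := by
    let w : ℕ → MvPolynomial (Fin 2) k :=
      fun n => Nat.rec 0 (fun j r => X 0 ^ (a (m - (j+1)) - a (m - (j+1) + 1)) * r
        + (pq (m - (j+1))).2) n
    have hw : ∀ j, w (j+1) = X 0 ^ (a (m - (j+1)) - a (m - (j+1) + 1)) * w j
        + (pq (m - (j+1))).2 := fun j => rfl
    refine ⟨fun i => w (m - i), ?_, ?_⟩
    · suffices ∀ n ≤ m, (w n).IsHomogeneous (a (m - n) + c) by
        intro i hi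
        have := this (m - i) (by omega)
        rwa [show m - (m - i) = i by omega] at this
      intro n
      induction n with
      | zero => intro _; exact isHomogeneous_zero _ _ _
      | succ n ih =>
        intro hn
        rw [hw]
        have hlt : m - (n+1) < m := by omega
        have han := ha _ hlt
        refine IsHomogeneous.add ?_ (hpq _ hlt).2.1
        convert (hXpow 0 (a (m - (n+1)) - a (m - (n+1) + 1))).mul (ih (by omega)) using 1
        rw [show m - n = m - (n+1) + 1 by omega]
        omega
    · intro j hj
      have := hw (m - (j+1))
      rw [show m - (j+1) + 1 = m - j by omega, show m - (m - j) = j by omega] at this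
      exact this
  obtain ⟨u, hu, hu'⟩ := hU
  obtain ⟨v, hv, hv'⟩ := hV
  refine ⟨fun i => X 0 ^ a i * u i + X 1 ^ b i * v i, ?_, ?_⟩
  · intro i hi
    refine IsHomogeneous.add ?_ ?_
    · convert (hXpow 0 (a i)).mul (hu i hi) using 1; omega
    · convert (hXpow 1 (b i)).mul (hv i hi) using 1; omega
  · intro j hj
    obtain ⟨x, hx⟩ := Nat.exists_eq_add_of_lt (ha j hj)
    obtain ⟨y, hy⟩ := Nat.exists_eq_add_of_lt (hb j hj)
    beta_reduce
    rw [(hpq j hj).2.2, hv' j hj, hu' j]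
    rw [show a j - a (j+1) = x + 1 by omega, show b (j+1) - b j = y + 1 by omega, hx, hy]
    ring

end HomCalc

namespace HomCalc

variable {k : Type*} [Field k]

lemma per_degree (m : ℕ) (a b : ℕ → ℕ)
    (ha : ∀ i < m, a (i+1) < a i) (hb : ∀ i < m, b i < b (i+1))
    (I : Ideal (MvPolynomial (Fin 2) k))
    (hI : I = Ideal.span ((fun i => X 0 ^ a i * X 1 ^ b i) '' Set.Iic m))
    [FiniteDimensional k (MvPolynomial (Fin 2) k ⧸ I)] (c : ℕ) :
    Module.finrank k (HomC k I c) + ∑ j ∈ Finset.range m, lam k I (a j + b (j+1) + c) =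
      ∑ i ∈ Finset.range (m+1), lam k I (a i + b i + c) := by
  classical
  let P : Fin (m+1) → Submodule k (MvPolynomial (Fin 2) k ⧸ I) :=
    fun i => quotPieceT k I (a i + b i + c)
  let Q : Fin m → Submodule k (MvPolynomial (Fin 2) k ⧸ I) :=
    fun j => quotPieceT k I (a j + b (j+1) + c)
  have hXpow : ∀ (i : Fin 2) (n : ℕ), (X i ^ n : MvPolynomial (Fin 2) k).IsHomogeneous n := by
    intro i n
    simpa using (isHomogeneous_X k i).pow n
  let D : ((i : Fin (m+1)) → P i) →ₗ[k] ((j : Fin m) → Q j) :=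
    { toFun := fun f j => ⟨Ideal.Quotient.mk I (X 1 ^ (b (j+1) - b j)) * (f j.castSucc : _ ⧸ I) -
          Ideal.Quotient.mk I (X 0 ^ (a j - a (j+1))) * (f j.succ : _ ⧸ I), by
          have h1 := hb j j.2
          have h2 := ha j j.2
          refine Submodule.sub_mem _ ?_ ?_
          · refine mul_mem_quotPiece I _ _ _ _ (hXpow _ _) _ (f j.castSucc).2 ?_
            simp only [Fin.val_castSucc]; omega
          · refine mul_mem_quotPiece I _ _ _ _ (hXpow _ _) _ (f j.succ).2 ?_
            simp only [Fin.val_succ]; omega⟩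
      map_add' := fun f g => by
        ext j
        simp only [Pi.add_apply, Submodule.coe_add]
        ring
      map_smul' := fun r f => by
        ext j
        simp only [Pi.smul_apply, Submodule.coe_smul, RingHom.id_apply, mul_smul_comm, smul_sub] }
  let E : HomC k I c →ₗ[k] ((i : Fin (m+1)) → P i) :=
    { toFun := fun φ i => ⟨φ.1 ⟨mon k (a i) (b i), gen_mem m a b I hI i (by omega)⟩,
        φ.2 (a i + b i) _ (mon_hom _ _)⟩
      map_add' := fun f g => by ext j; simp
      map_smul' := fun r f => by ext j; simp }
  have hEinj : Function.Injective E := by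
    rw [injective_iff_map_eq_zero]
    intro φ hφ
    apply Subtype.ext
    apply LinearMap.ext
    rintro ⟨g, hg⟩
    have hgen : ∀ i ≤ m, ∀ h : mon k (a i) (b i) ∈ I, φ.1 ⟨mon k (a i) (b i), h⟩ = 0 := by
      intro i hi h
      have := congrFun hφ ⟨i, by omega⟩
      exact congrArg Subtype.val this
    have hg' : g ∈ Ideal.span ((fun i => X 0 ^ a i * X 1 ^ b i) '' Set.Iic m) := hI ▸ hg
    have key : ∀ h : g ∈ I, φ.1 ⟨g, h⟩ = 0 := by
      clear hg
      induction hg' using Submodule.span_induction with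
      | mem x hx =>
        obtain ⟨i, hi, rfl⟩ := hx
        exact hgen i hi
      | zero => intro h; exact map_zero φ.1
      | add x y hx hy ihx ihy =>
        intro h
        have hx' : x ∈ I := by rw [hI]; exact hx
        have hy' : y ∈ I := by rw [hI]; exact hy
        have := map_add φ.1 ⟨x, hx'⟩ ⟨y, hy'⟩
        rw [ihx hx', ihy hy', add_zero] at this
        exact this
      | smul r x hx ihx =>
        intro h
        have hx' : x ∈ I := by rw [hI]; exact hx
        have := map_smul φ.1 r ⟨x, hx'⟩
        rw [ihx hx', smul_zero] at this
        exact this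
    exact key hg
  have hker : LinearMap.range E = LinearMap.ker D := by
    apply le_antisymm
    · rintro _ ⟨φ, rfl⟩
      rw [LinearMap.mem_ker]
      ext j
      have h1 := hb j j.2
      have h2 := ha j j.2
      have g1 := gen_mem m a b I hI j (by omega)
      have g2 := gen_mem m a b I hI (j+1) (by omega)
      change Ideal.Quotient.mk I (X 1 ^ (b (j+1) - b j)) * φ.1 ⟨mon k (a j) (b j), g1⟩ -
        Ideal.Quotient.mk I (X 0 ^ (a j - a (j+1))) *
          φ.1 ⟨mon k (a (j+1)) (b (j+1)), g2⟩ = 0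
      have e1 := map_smul φ.1 (X 1 ^ (b (j+1) - b j)) ⟨mon k (a j) (b j), g1⟩
      have e2 := map_smul φ.1 (X 0 ^ (a j - a (j+1))) ⟨mon k (a (j+1)) (b (j+1)), g2⟩
      have e3 : (X 1 ^ (b (j+1) - b j) : MvPolynomial (Fin 2) k) •
          (⟨mon k (a j) (b j), g1⟩ : I) =
          (X 0 ^ (a j - a (j+1)) : MvPolynomial (Fin 2) k) •
            (⟨mon k (a (j+1)) (b (j+1)), g2⟩ : I) := by
        apply Subtype.ext
        change X 1 ^ (b (j+1) - b j) * mon k (a j) (b j) =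
          X 0 ^ (a j - a (j+1)) * mon k (a (j+1)) (b (j+1))
        simp only [mon]
        rw [mul_left_comm, ← pow_add, ← mul_assoc, ← pow_add, Nat.sub_add_cancel h1.le,
          Nat.sub_add_cancel h2.le]
      rw [e3] at e1
      rw [sub_eq_zero]
      exact e1.symm.trans e2
    · intro f hf
      rw [LinearMap.mem_ker] at hf
      let f' : ℕ → MvPolynomial (Fin 2) k ⧸ I := fun i => if h : i < m + 1 then f ⟨i, h⟩ else 0
      have hf' : ∀ i (h : i < m + 1), f' i = f ⟨i, h⟩ := fun i h => dif_pos h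
      obtain ⟨φ, hφ, hφ'⟩ := exists_hom m a b ha hb I hI f' (by
        intro j hj
        rw [hf' j (by omega), hf' (j+1) (by omega)]
        have := congrArg Subtype.val (congrFun hf ⟨j, hj⟩)
        exact sub_eq_zero.mp this) c (by
        intro i hi
        rw [hf' i (by omega)]
        exact (f ⟨i, by omega⟩).2)
      refine ⟨⟨φ, hφ⟩, ?_⟩
      ext i
      have := hφ' i (by omega) (gen_mem m a b I hI i (by omega))
      rw [hf' i i.2] at this
      exact this
  have hsurj : LinearMap.range D = ⊤ := by
    rw [LinearMap.range_eq_top]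
    intro g
    have hl : ∀ j, ∃ G : MvPolynomial (Fin 2) k, ∀ hj : j < m,
        G.IsHomogeneous (a j + b (j+1) + c) ∧ Ideal.Quotient.mk I G = g ⟨j, hj⟩ := by
      intro j
      by_cases hj : j < m
      · obtain ⟨G, hG⟩ := (mem_quotPiece I _ _).mp (g ⟨j, hj⟩).2
        exact ⟨G, fun _ => hG⟩
      · exact ⟨0, fun h => absurd h hj⟩
    choose G hG using hl
    obtain ⟨f, hf, hf'⟩ := surj m a b ha hb c G (fun j hj => (hG j hj).1)
    refine ⟨fun i => ⟨Ideal.Quotient.mk I (f i),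
      (mem_quotPiece I _ _).mpr ⟨f i, hf i (by omega), rfl⟩⟩, ?_⟩
    ext j
    rw [← (hG j j.2).2, ← hf' j j.2, map_sub, map_mul, map_mul]
    rfl
  have h1 := LinearMap.finrank_range_add_finrank_ker D
  rw [← hker, LinearMap.finrank_range_of_inj hEinj, hsurj, finrank_top,
    Module.finrank_pi_fintype, Module.finrank_pi_fintype] at h1
  simp only [P, Q, finrank_quotPiece m a b I hI] at h1
  rw [Finset.sum_range, Finset.sum_range, add_comm]
  exact h1

lemma finsum_shift (g : ℕ → ℕ) (e N : ℕ) (hg : ∀ d, N ≤ d → g d = 0) :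
    ∑ᶠ d ∈ {d : ℕ | e < d}, g d = ∑ c ∈ Finset.range N, g (e + (c + 1)) := by
  have : {d : ℕ | e < d} = Set.range (fun c => e + (c + 1)) := by
    ext d
    simp only [Set.mem_ofPred_eq, Set.mem_range]
    constructor
    · intro h; exact ⟨d - e - 1, by omega⟩
    · rintro ⟨c, rfl⟩; omega
  rw [this, finsum_mem_range (fun x y h => by simpa using h)]
  apply finsum_eq_sum_of_support_subset
  intro c hc
  by_contra h
  apply hc
  simp only [Finset.coe_range, Set.mem_Iio, not_lt] at h
  exact hg _ (by omega)

end HomCalc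

/-- The minimal monomial generators of `I` are `α₁^(a i)·α₂^(b i)` for `i = 0, …, m`.
The stated equation `Σ_{c>0} dim Hom_T(I,T/I)_c = A - B` is formalized as
`Σ_{c>0} dim Hom_T(I,T/I)_c + B = A`. -/
theorem sum_dim_hom_eq (k : Type*) [Field k] [IsAlgClosed k]
    (m : ℕ) (hm : 1 ≤ m) (a b : ℕ → ℕ)
    (ha : ∀ i < m, a (i+1) < a i) (ham : a m = 0)
    (hb0 : b 0 = 0) (hb : ∀ i < m, b i < b (i+1))
    (I : Ideal (MvPolynomial (Fin 2) k))
    (hI : I = Ideal.span ((fun i => X 0 ^ a i * X 1 ^ b i) '' Set.Iic m))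
    (r : ℕ) (hr : 0 < r)
    (hdim : Module.finrank k (MvPolynomial (Fin 2) k ⧸ I) = r) :
    (∑ᶠ c ∈ {c : ℕ | 0 < c}, Module.finrank k ↥(HomC k I c)) +
        ∑ i ∈ Finset.Icc 1 m, ∑ᶠ deg ∈ {deg : ℕ | a (i-1) + b i < deg}, lam k I deg =
      ∑ i ∈ Finset.range (m+1), ∑ᶠ deg ∈ {deg : ℕ | a i + b i < deg}, lam k I deg := by
  have : FiniteDimensional k (MvPolynomial (Fin 2) k ⧸ I) :=
    Module.finite_of_finrank_pos (by omega)
  have hper := HomCalc.per_degree m a b ha hb I hI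
  set N := a 0 + b m with hN
  have hlam : ∀ d, N ≤ d → lam k I d = 0 := HomCalc.lam_zero m a b ham hb0 I hI
  have hH : ∀ c, N ≤ c → Module.finrank k (HomC k I c) = 0 := by
    intro c hc
    have h := hper c
    rw [Finset.sum_eq_zero (s := Finset.range (m+1)) (fun i _ => hlam _ (by omega))] at h
    omega
  rw [HomCalc.finsum_shift _ 0 N hH]
  simp only [HomCalc.finsum_shift _ _ N hlam]
  rw [Finset.sum_comm, Finset.sum_comm (s := Finset.range (m+1)), ← Finset.sum_add_distrib]
  refine Finset.sum_congr rfl fun c _ => ?_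
  rw [← hper (c+1), zero_add]
  congr 1
  rw [← Finset.Ico_add_one_right_eq_Icc, Finset.sum_Ico_eq_sum_range]
  refine Finset.sum_congr (by simp) fun j _ => ?_
  rw [show 1 + j - 1 = j by omega, add_comm 1 j]
end
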